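/- There exists a universal constant K > 0 such that the following holds. Let 𝓕 be a countable class of measurable functions from S into [0,1], X₁,…,Xₙ i.i.d. with law P (n ≥ 3), and let ψ_n be a (possibly data-dependent) nondecreasing concave function with ψ_n(0) = 0 satisfying E_ε[ sup{ |R_n(f)| : f ∈ 𝓕, P_n f ≤ r } ] ≤ ψ_n(√r) for all r ≥ 0, and let r̂_n be the largest solution of the equation r = ψ_n(√r). Then for every t > 0, with probability at least 1 − 2e^{−t}, simultaneously for all f ∈ 𝓕: P f ≤ K·( P_n f + r̂_n + (t + log log n)/n ). -/

import Mathlib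

open MeasureTheory ProbabilityTheory Real Set

noncomputable section

/-- The `ε`-covering number of `F`: the minimal number of closed balls of radius `ε`
with centers in `F` needed to cover `F`. -/
def coveringNum {E : Type*} [PseudoMetricSpace E] (F : Set E) (ε : ℝ) : ℕ :=
  sInf {n : ℕ | ∃ s : Finset E, ↑s ⊆ F ∧ s.card = n ∧ F ⊆ ⋃ c ∈ s, Metric.closedBall c ε}

/-- The `ε`-entropy of `F`. -/
def entropy {E : Type*} [PseudoMetricSpace E] (F : Set E) (ε : ℝ) : ℝ :=
  Real.log (coveringNum F ε)

/-- `W` is an isonormal Gaussian process on the Hilbert space `H` with respect to the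
probability measure `μ`: every finite linear combination `∑ cᵢ • W (hᵢ)` is a centered
Gaussian random variable with variance `‖∑ cᵢ • hᵢ‖²`; in particular each `W h` is
centered Gaussian and `E[W h * W h'] = ⟪h, h'⟫`. -/
structure IsIsonormal {H : Type*} [NormedAddCommGroup H] [InnerProductSpace ℝ H]
    {Ω : Type*} [MeasurableSpace Ω] (μ : Measure Ω) (W : H → Ω → ℝ) : Prop where
  meas : ∀ h, Measurable (W h)
  gaussian : ∀ (m : ℕ) (h : Fin m → H) (c : Fin m → ℝ),
    μ.map (fun ω => ∑ i, c i * W (h i) ω) = gaussianReal 0 (‖∑ i, c i • h i‖₊ ^ 2)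

/-- The continuity modulus `ω(F, δ)` of the process `W` on the class `F`. -/
def modulus {H : Type*} [NormedAddCommGroup H] [InnerProductSpace ℝ H]
    {Ω : Type*} [MeasurableSpace Ω] (μ : Measure Ω) (W : H → Ω → ℝ)
    (F : Set H) (δ : ℝ) : ℝ :=
  ∫ ω, sSup {a : ℝ | ∃ f ∈ F, ∃ g ∈ F, ‖f - g‖ ≤ δ ∧ a = |W f ω - W g ω|} ∂μ

/-- `A` is a maximal `ε`-separated subset of `F`. -/
def IsMaxSeparated {E : Type*} [PseudoMetricSpace E] (F A : Set E) (ε : ℝ) : Prop :=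
  A ⊆ F ∧ (∀ x ∈ A, ∀ y ∈ A, x ≠ y → ε ≤ dist x y) ∧
    ∀ B : Set E, A ⊆ B → B ⊆ F → (∀ x ∈ B, ∀ y ∈ B, x ≠ y → ε ≤ dist x y) → B = A
/-- The sign `±1` associated to a Boolean coin flip. -/
def radSign (b : Bool) : ℝ := if b then 1 else -1

/-- The law of `n` i.i.d. Rademacher (fair ±1) coin flips. -/
def radMeasure (n : ℕ) : Measure (Fin n → Bool) :=
  Measure.pi fun _ => (PMF.uniformOfFintype Bool).toMeasure

/-- Empirical mean `P_n f = n⁻¹ ∑ f(xᵢ)`. -/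
def empMean {S : Type*} (n : ℕ) (x : Fin n → S) (f : S → ℝ) : ℝ :=
  (∑ i, f (x i)) / n

/-- Rademacher average `R_n f = n⁻¹ ∑ εᵢ f(xᵢ)`. -/
def radAvg {S : Type*} (n : ℕ) (x : Fin n → S) (σ : Fin n → Bool) (f : S → ℝ) : ℝ :=
  (∑ i, radSign (σ i) * f (x i)) / n

/-- `E_ε [ sup { |R_n f| : f ∈ 𝓕, P_n f ≤ u } ]`, the localized Rademacher complexity
(conditionally on the sample `x`). -/
def radSup {S : Type*} (n : ℕ) (𝓕 : Set (S → ℝ)) (x : Fin n → S) (u : ℝ) : ℝ :=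
  ∫ σ, sSup {a : ℝ | ∃ f ∈ 𝓕, empMean n x f ≤ u ∧ a = |radAvg n x σ f|} ∂(radMeasure n)



/-- Bounded measurable real function. -/
def BM {α : Type*} [MeasurableSpace α] (g : α → ℝ) : Prop :=
  Measurable g ∧ ∃ C : ℝ, ∀ x, |g x| ≤ C

namespace BM
variable {α β : Type*} [MeasurableSpace α] [MeasurableSpace β]

theorem integrable {g : α → ℝ} (h : BM g) (μ : Measure α) [IsFiniteMeasure μ] :
    Integrable g μ := by
  obtain ⟨hm, C, hC⟩ := h
  exact Integrable.of_bound hm.aestronglyMeasurable C (Filter.Eventually.of_forall hC)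

theorem const (c : ℝ) : BM (fun _ : α => c) := ⟨measurable_const, |c|, fun _ => le_rfl⟩

theorem add {f g : α → ℝ} (hf : BM f) (hg : BM g) : BM (fun x => f x + g x) := by
  obtain ⟨hm, C, hC⟩ := hf
  obtain ⟨hm', C', hC'⟩ := hg
  exact ⟨hm.add hm', C + C', fun x => (abs_add_le _ _).trans (add_le_add (hC x) (hC' x))⟩

theorem mul {f g : α → ℝ} (hf : BM f) (hg : BM g) : BM (fun x => f x * g x) := by
  obtain ⟨hm, C, hC⟩ := hf
  obtain ⟨hm', C', hC'⟩ := hg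
  refine ⟨hm.mul hm', C * C', fun x => ?_⟩
  rw [abs_mul]
  exact mul_le_mul (hC x) (hC' x) (abs_nonneg _) ((abs_nonneg _).trans (hC x))

theorem neg {f : α → ℝ} (hf : BM f) : BM (fun x => - f x) := by
  obtain ⟨hm, C, hC⟩ := hf
  exact ⟨hm.neg, C, fun x => by rw [abs_neg]; exact hC x⟩

theorem sub {f g : α → ℝ} (hf : BM f) (hg : BM g) : BM (fun x => f x - g x) := by
  simpa [sub_eq_add_neg] using hf.add hg.neg

theorem abs {f : α → ℝ} (hf : BM f) : BM (fun x => |f x|) := by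
  obtain ⟨hm, C, hC⟩ := hf
  exact ⟨hm.abs, C, fun x => by rw [abs_abs]; exact hC x⟩

theorem exp {f : α → ℝ} (hf : BM f) : BM (fun x => Real.exp (f x)) := by
  obtain ⟨hm, C, hC⟩ := hf
  refine ⟨hm.exp, Real.exp C, fun x => ?_⟩
  rw [abs_of_pos (Real.exp_pos _)]
  exact Real.exp_le_exp.2 ((le_abs_self _).trans (hC x))

theorem comp {f : α → ℝ} (hf : BM f) {e : β → α} (he : Measurable e) :
    BM (fun x => f (e x)) := by
  obtain ⟨hm, C, hC⟩ := hf
  exact ⟨hm.comp he, C, fun x => hC _⟩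

theorem sum {ι : Type*} (s : Finset ι) {f : ι → α → ℝ} (hf : ∀ i, BM (f i)) :
    BM (fun x => ∑ i ∈ s, f i x) := by
  classical
  induction s using Finset.induction_on with
  | empty => simpa using const 0
  | insert a s ha ih =>
    simp only [Finset.sum_insert ha]
    exact (hf a).add ih

theorem iSup {ι : Type*} [Finite ι] [Nonempty ι] {f : ι → α → ℝ} (hf : ∀ i, BM (f i)) :
    BM (fun x => ⨆ i, f i x) := by
  choose hm C hC using hf
  refine ⟨Measurable.iSup hm, ⨆ i, C i, fun x => ?_⟩
  obtain ⟨j, hj⟩ := exists_eq_ciSup_of_finite (f := fun i => f i x)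
  show |⨆ i, f i x| ≤ _
  rw [← hj]
  exact (hC j x).trans (le_ciSup (Finite.bddAbove_range C) j)

theorem intg {f : α × β → ℝ} (hf : BM f) (ν : Measure β) [IsProbabilityMeasure ν] :
    BM (fun x => ∫ y, f (x, y) ∂ν) := by
  obtain ⟨hm, C, hC⟩ := hf
  refine ⟨(hm.stronglyMeasurable.integral_prod_right' (ν := ν)).measurable, C, fun x => ?_⟩
  have := norm_integral_le_of_norm_le_const (μ := ν) (f := fun y => f (x, y)) (C := C)
    (Filter.Eventually.of_forall fun y => hC _)
  simpa using this

theorem log_of {f : α → ℝ} (hf : BM f) {c : ℝ} (hc : 0 < c) (h : ∀ x, c ≤ f x) :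
    BM (fun x => Real.log (f x)) := by
  obtain ⟨hm, C, hC⟩ := hf
  refine ⟨hm.log, max |Real.log c| |Real.log C|, fun x => ?_⟩
  have h1 : Real.log c ≤ Real.log (f x) := Real.log_le_log hc (h x)
  have h2 : Real.log (f x) ≤ Real.log C :=
    Real.log_le_log (hc.trans_le (h x)) ((le_abs_self _).trans (hC x))
  rw [abs_le]
  constructor
  · have := neg_abs_le (Real.log c)
    have := le_max_left |Real.log c| |Real.log C|
    linarith
  · have := le_abs_self (Real.log C)
    have := le_max_right |Real.log c| |Real.log C|
    linarith

end BM

/-- Non-dependent cons. -/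
def fcons {S : Type*} {n : ℕ} (s : S) (y : Fin n → S) : Fin (n+1) → S := Fin.cons s y

theorem fcons_eq {S : Type*} [MeasurableSpace S] {n : ℕ} (z : S × (Fin n → S)) :
    (MeasurableEquiv.piFinSuccAbove (fun _ : Fin (n+1) => S) 0).symm z = fcons z.1 z.2 := by
  show Fin.insertNth (α := fun _ => S) 0 z.1 z.2 = _
  rw [Fin.insertNth_zero]
  rfl

theorem fcons_update_zero {S : Type*} {n : ℕ} (s s' : S) (y : Fin n → S) :
    Function.update (fcons s y) 0 s' = fcons s' y := by
  simp [fcons]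

theorem fcons_update_succ {S : Type*} {n : ℕ} (s s' : S) (y : Fin n → S) (i : Fin n) :
    Function.update (fcons s y) i.succ s' = fcons s (Function.update y i s') := by
  simp [fcons]

theorem integral_cons {S : Type*} [MeasurableSpace S] (P : Measure S) [IsProbabilityMeasure P]
    (n : ℕ) {g : (Fin (n+1) → S) → ℝ} (hg : BM g) :
    ∫ x, g x ∂(Measure.pi fun _ : Fin (n+1) => P) =
      ∫ s, ∫ y, g (fcons s y) ∂(Measure.pi fun _ : Fin n => P) ∂P := by
  have h := (measurePreserving_piFinSuccAbove (fun _ : Fin (n+1) => P) 0).symm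
  rw [← h.integral_comp' (g := g)]
  have hb : BM (fun z : S × (Fin n → S) => g ((MeasurableEquiv.piFinSuccAbove (fun _ => S) 0).symm z)) :=
    hg.comp (MeasurableEquiv.measurable _)
  rw [integral_prod _ (hb.integrable _)]
  simp_rw [fcons_eq]

theorem measurable_cons {S : Type*} [MeasurableSpace S] (n : ℕ) :
    Measurable (fun z : S × (Fin n → S) => fcons z.1 z.2) := by
  simp_rw [← fcons_eq]
  exact (MeasurableEquiv.piFinSuccAbove (fun _ : Fin (n+1) => S) 0).symm.measurable

theorem young (u L : ℝ) : Real.exp u * L ≤ Real.exp u * u - Real.exp u + Real.exp L := by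
  have h := Real.add_one_le_exp (L - u)
  have : Real.exp L = Real.exp u * Real.exp (L - u) := by rw [← Real.exp_add]; ring_nf
  rw [this]
  nlinarith [Real.exp_pos u]

set_option maxHeartbeats 1000000 in
theorem ent_tensor {S : Type*} [MeasurableSpace S] (P : Measure S) [IsProbabilityMeasure P] :
    ∀ (n : ℕ) (Y : (Fin n → S) → ℝ) (Yi : Fin n → (Fin n → S) → ℝ), BM Y → (∀ i, BM (Yi i)) →
    (∀ i x s, Yi i (Function.update x i s) = Yi i x) →
    ∫ x, Y x * exp (Y x) ∂(Measure.pi fun _ : Fin n => P)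
      - (∫ x, exp (Y x) ∂(Measure.pi fun _ : Fin n => P)) *
        Real.log (∫ x, exp (Y x) ∂(Measure.pi fun _ : Fin n => P)) ≤
    ∑ i, ∫ x, (exp (Y x) * (Y x - Yi i x) - exp (Y x) + exp (Yi i x))
      ∂(Measure.pi fun _ : Fin n => P) := by
  intro n
  induction n with
  | zero =>
    intro Y Yi hY hYi hi
    have : ∀ x, Y x = Y default := fun x => by rw [Subsingleton.elim x default]
    simp [this]
    linarith
  | succ n ih =>
    intro Y Yi hY hYi hi
    set μ := Measure.pi fun _ : Fin n => P with hμ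
    have hc := measurable_cons (S := S) n
    have hcs : ∀ s : S, Measurable (fun y : Fin n → S => fcons s y) :=
      fun s => hc.comp measurable_prodMk_left
    have hD : ∀ i, BM (fun x => exp (Y x) * (Y x - Yi i x) - exp (Y x) + exp (Yi i x)) :=
      fun i => ((hY.exp.mul (hY.sub (hYi i))).sub hY.exp).add (hYi i).exp
    rw [integral_cons P n (hY.mul hY.exp), integral_cons P n hY.exp, Fin.sum_univ_succ,
      integral_cons P n (hD 0)]
    rw [Finset.sum_congr rfl fun i _ => integral_cons P n (hD (Fin.succ i))]
    set m : S → ℝ := fun s => ∫ y, exp (Y (fcons s y)) ∂μ with hm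
    set M : ℝ := ∫ s, m s ∂P with hM
    have hmBM : BM m := (hY.exp.comp hc).intg μ
    obtain ⟨C, hC⟩ := hY.2
    have hmlow : ∀ s, exp (-C) ≤ m s := by
      intro s
      have : ∫ y, exp (-C) ∂μ ≤ m s := by
        apply integral_mono (integrable_const _) ((hY.exp.comp (hcs s)).integrable _)
        intro y
        exact Real.exp_le_exp.2 (neg_le_of_abs_le (hC _))
      simpa using this
    have hmpos : ∀ s, 0 < m s := fun s => (exp_pos _).trans_le (hmlow s)
    have hMpos : 0 < M := by
      have : ∫ s, exp (-C) ∂P ≤ M :=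
        integral_mono (integrable_const _) (hmBM.integrable _) hmlow
      simp at this
      exact (exp_pos _).trans_le this
    have hlogBM : BM (fun s => Real.log (m s)) := hmBM.log_of (exp_pos _) hmlow
    -- first part
    have h1 : ∫ s, (∫ y, Y (fcons s y) * exp (Y (fcons s y)) ∂μ) - m s * Real.log (m s) ∂P ≤
        ∫ s, ∑ i : Fin n, ∫ y, (exp (Y (fcons s y)) * (Y (fcons s y) - Yi i.succ (fcons s y))
          - exp (Y (fcons s y)) + exp (Yi i.succ (fcons s y))) ∂μ ∂P := by
      apply integral_mono
      · exact ((((hY.mul hY.exp).comp hc).intg μ).sub (hmBM.mul hlogBM)).integrable _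
      · exact (BM.sum _ fun (i : Fin n) => ((hD i.succ).comp hc).intg μ).integrable _
      intro s
      refine ih (fun y => Y (fcons s y)) (fun i y => Yi i.succ (fcons s y)) (hY.comp (hcs s))
        (fun i => (hYi _).comp (hcs s)) ?_
      intro i x s'
      have := hi i.succ (fcons s x) s'
      simpa only [fcons_update_succ] using this
    rw [integral_sub ((((hY.mul hY.exp).comp hc).intg μ).integrable _)
      ((hmBM.mul hlogBM).integrable _), integral_finsetSum _ (fun i _ =>
        (((hD (Fin.succ i)).comp hc).intg μ).integrable _)] at h1
    -- second part
    have hq : ∀ s s', ∫ y, exp (Yi 0 (fcons s y)) ∂μ = ∫ y, exp (Yi 0 (fcons s' y)) ∂μ := by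
      intro s s'
      congr 1
      ext y
      have := hi 0 (fcons s' y) s
      simp only [fcons_update_zero] at this
      rw [this]
    have h2 : ∀ s, m s * Real.log (m s) - m s * Real.log M ≤
        (∫ y, (exp (Y (fcons s y)) * (Y (fcons s y) - Yi 0 (fcons s y))
          - exp (Y (fcons s y))) ∂μ) + (∫ y, exp (Yi 0 (fcons s y)) ∂μ) * (m s / M) := by
      intro s
      have e1 : m s * Real.log (m s) - m s * Real.log M =
          ∫ y, exp (Y (fcons s y)) * (Real.log (m s / M)) ∂μ := by
        rw [integral_mul_const, Real.log_div (hmpos s).ne' hMpos.ne']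
        ring
      rw [e1, ← integral_mul_const, ← integral_add]
      · apply integral_mono
        · exact ((hY.exp.comp (hcs s)).mul (BM.const _)).integrable _
        · exact ((((hY.exp.mul (hY.sub (hYi 0))).sub hY.exp).comp (hcs s)).add
            (((hYi 0).exp.comp (hcs s)).mul (BM.const _))).integrable _
        intro y
        have hy := young (Y (fcons s y) - Yi 0 (fcons s y)) (Real.log (m s / M))
        rw [Real.exp_log (div_pos (hmpos s) hMpos)] at hy
        have e2 : exp (Y (fcons s y)) = exp (Yi 0 (fcons s y)) *
          exp (Y (fcons s y) - Yi 0 (fcons s y)) := by rw [← exp_add]; ring_nf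
        have e3 := mul_le_mul_of_nonneg_left hy (exp_pos (Yi 0 (fcons s y))).le
        simp only []
        rw [e2]
        nlinarith [e3]
      · exact (((hY.exp.mul (hY.sub (hYi 0))).sub hY.exp).comp (hcs s)).integrable _
      · exact (((hYi 0).exp.comp (hcs s)).mul (BM.const _)).integrable _
    have hb1 : BM (fun s => ∫ y, (exp (Y (fcons s y)) * (Y (fcons s y) - Yi 0 (fcons s y))
          - exp (Y (fcons s y))) ∂μ) :=
      (((hY.exp.mul (hY.sub (hYi 0))).sub hY.exp).comp hc).intg μ
    have hb2 : BM (fun s => ∫ y, exp (Yi 0 (fcons s y)) ∂μ) := ((hYi 0).exp.comp hc).intg μ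
    have h3 : ∫ s, (m s * Real.log (m s) - m s * Real.log M) ∂P ≤
        ∫ s, ((∫ y, (exp (Y (fcons s y)) * (Y (fcons s y) - Yi 0 (fcons s y))
          - exp (Y (fcons s y))) ∂μ) + (∫ y, exp (Yi 0 (fcons s y)) ∂μ) * (m s / M)) ∂P := by
      apply integral_mono _ _ h2
      · exact ((hmBM.mul hlogBM).sub (hmBM.mul (BM.const _))).integrable _
      · exact (hb1.add (hb2.mul (by simpa [div_eq_mul_inv] using hmBM.mul (BM.const M⁻¹)))).integrable _
    obtain ⟨s0⟩ : Nonempty S := P.nonempty_of_neZero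
    have e4 : ∀ s, (∫ y, exp (Yi 0 (fcons s y)) ∂μ) = ∫ y, exp (Yi 0 (fcons s0 y)) ∂μ :=
      fun s => hq s s0
    have e5 : ∫ s, ∫ y, (exp (Y (fcons s y)) * (Y (fcons s y) - Yi 0 (fcons s y))
          - exp (Y (fcons s y)) + exp (Yi 0 (fcons s y))) ∂μ ∂P =
        (∫ s, (∫ y, (exp (Y (fcons s y)) * (Y (fcons s y) - Yi 0 (fcons s y))
          - exp (Y (fcons s y))) ∂μ) ∂P) + ∫ y, exp (Yi 0 (fcons s0 y)) ∂μ := by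
      have : ∀ s, ∫ y, (exp (Y (fcons s y)) * (Y (fcons s y) - Yi 0 (fcons s y))
          - exp (Y (fcons s y)) + exp (Yi 0 (fcons s y))) ∂μ =
          (∫ y, (exp (Y (fcons s y)) * (Y (fcons s y) - Yi 0 (fcons s y))
          - exp (Y (fcons s y))) ∂μ) + ∫ y, exp (Yi 0 (fcons s0 y)) ∂μ := by
        intro s
        rw [← e4 s, integral_add]
        · exact (((hY.exp.mul (hY.sub (hYi 0))).sub hY.exp).comp (hcs s)).integrable _
        · exact ((hYi 0).exp.comp (hcs s)).integrable _
      simp_rw [this]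
      rw [integral_add (hb1.integrable _) (integrable_const _)]
      simp
    rw [e5]
    simp_rw [e4] at h3
    rw [integral_sub ((hmBM.mul hlogBM).integrable _) ((hmBM.mul (BM.const _)).integrable _),
      integral_mul_const, integral_add (hb1.integrable _)
        (((BM.const _).mul (by simpa [div_eq_mul_inv] using hmBM.mul (BM.const M⁻¹))).integrable _),
      integral_const_mul, integral_div, ← hM, div_self hMpos.ne', mul_one] at h3
    linarith



theorem herbst {Ω : Type*} [MeasurableSpace Ω] (μ : Measure Ω) [IsProbabilityMeasure μ]
    {Y : Ω → ℝ} (hY : BM Y) (a b : ℝ)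
    (h : ∀ l : ℝ, 0 < l → l ≤ 1 →
      l * ∫ x, Y x * exp (l * Y x) ∂μ - (∫ x, exp (l * Y x) ∂μ) * Real.log (∫ x, exp (l * Y x) ∂μ)
      ≤ l ^ 2 * (a * ∫ x, Y x * exp (l * Y x) ∂μ + b * ∫ x, exp (l * Y x) ∂μ))
    (l : ℝ) (hl : 0 < l) (hl1 : l ≤ 1) :
    cgf Y μ l / l - a * cgf Y μ l - b * l ≤ ∫ x, Y x ∂μ := by
  have hInt0 : ∀ v : ℝ, v ∈ interior (integrableExpSet Y μ) := by
    intro v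
    have : integrableExpSet Y μ = univ := by
      ext v
      simp only [integrableExpSet, mem_ofPred_eq, mem_univ, iff_true]
      exact (((BM.const v).mul hY).exp).integrable μ
    simp [this]
  have hd : ∀ v : ℝ, HasDerivAt (cgf Y μ) (μ[fun x => Y x * exp (v * Y x)] / mgf Y μ v) v := by
    intro v
    rw [← deriv_cgf (hInt0 v)]
    exact (analyticAt_cgf (hInt0 v)).differentiableAt.hasDerivAt
  set q : ℝ → ℝ := fun l => cgf Y μ l / l - a * cgf Y μ l - b * l with hq
  have hqd : ∀ v : ℝ, 0 < v → HasDerivAt q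
      (((μ[fun x => Y x * exp (v * Y x)] / mgf Y μ v) * v - cgf Y μ v * 1) / v ^ 2 -
        a * (μ[fun x => Y x * exp (v * Y x)] / mgf Y μ v) - b * 1) v := by
    intro v hv
    exact (((hd v).div (hasDerivAt_id v) hv.ne').sub ((hd v).const_mul a)).sub
      ((hasDerivAt_id v).const_mul b)
  have hanti : AntitoneOn q (Ioc 0 1) := by
    apply antitoneOn_of_deriv_nonpos (convex_Ioc 0 1)
    · intro v hv
      exact (hqd v hv.1).continuousAt.continuousWithinAt
    · intro v hv
      rw [interior_Ioc] at hv
      exact (hqd v hv.1).differentiableAt.differentiableWithinAt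
    · intro v hv
      rw [interior_Ioc] at hv
      rw [(hqd v hv.1).deriv]
      have h1 := h v hv.1 hv.2.le
      have hM : 0 < mgf Y μ v := mgf_pos ((((BM.const v).mul hY).exp).integrable μ)
      have e1 : (∫ x, exp (v * Y x) ∂μ) = mgf Y μ v := rfl
      have e2 : Real.log (mgf Y μ v) = cgf Y μ v := rfl
      rw [e1, e2] at h1
      set A := ∫ x, Y x * exp (v * Y x) ∂μ
      have hA : A = (A / mgf Y μ v) * mgf Y μ v := by field_simp
      set B := A / mgf Y μ v
      have hv0 := hv.1
      have h2 : mgf Y μ v * (v * B - cgf Y μ v) ≤ mgf Y μ v * (v ^ 2 * (a * B + b)) := by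
        rw [hA] at h1
        nlinarith [h1]
      have h3 := le_of_mul_le_mul_left h2 hM
      have h4 : (B * v - cgf Y μ v * 1) / v ^ 2 ≤ a * B + b := by
        rw [div_le_iff₀ (by positivity)]
        linarith
      linarith
  have hlim : Filter.Tendsto q (nhdsWithin 0 (Ioi 0)) (nhds (∫ x, Y x ∂μ)) := by
    have h0 := hd 0
    have h1 := hasDerivAt_iff_tendsto_slope.1 h0
    have h2 : Filter.Tendsto (slope (cgf Y μ) 0) (nhdsWithin 0 (Ioi 0))
        (nhds (∫ x, Y x ∂μ)) := by
      have := h1.mono_left (nhdsWithin_mono 0 (show Ioi (0:ℝ) ⊆ {0}ᶜ from fun x hx => ne_of_gt (show (0:ℝ) < x from hx)))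
      simpa using this
    have h3 : Filter.Tendsto (fun l => a * cgf Y μ l) (nhdsWithin 0 (Ioi 0)) (nhds 0) := by
      have := (h0.continuousAt.tendsto.const_mul a).mono_left
        (nhdsWithin_le_nhds (s := Ioi (0:ℝ)))
      simpa using this
    have h4 : Filter.Tendsto (fun l : ℝ => b * l) (nhdsWithin 0 (Ioi 0)) (nhds 0) := by
      have := ((continuous_const_mul b).tendsto (0:ℝ)).mono_left
        (nhdsWithin_le_nhds (s := Ioi (0:ℝ)))
      simpa using this
    have h5 := (h2.sub h3).sub h4
    simp only [sub_zero] at h5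
    refine h5.congr fun x => ?_
    simp [slope_def_field, hq]
  refine ge_of_tendsto hlim ?_
  filter_upwards [Ioo_mem_nhdsGT hl] with x hx
  exact hanti ⟨hx.1, hx.2.le.trans hl1⟩ ⟨hl, hl1⟩ hx.2.le

/-- entropy bound in the form needed. -/
theorem ent_bound {S : Type*} [MeasurableSpace S] (P : Measure S) [IsProbabilityMeasure P]
    (n : ℕ) {Y : (Fin n → S) → ℝ} {Yi : Fin n → (Fin n → S) → ℝ} (hY : BM Y)
    (hYi : ∀ i, BM (Yi i)) (hi : ∀ i x s, Yi i (Function.update x i s) = Yi i x)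
    (h1 : ∀ i x, |Y x - Yi i x| ≤ 1) (l : ℝ) (hl : 0 < l) (hl1 : l ≤ 1) :
    l * ∫ x, Y x * exp (l * Y x) ∂(Measure.pi fun _ : Fin n => P)
      - (∫ x, exp (l * Y x) ∂(Measure.pi fun _ : Fin n => P)) *
        Real.log (∫ x, exp (l * Y x) ∂(Measure.pi fun _ : Fin n => P)) ≤
    l ^ 2 * ∑ i, ∫ x, (Y x - Yi i x) ^ 2 * exp (l * Y x) ∂(Measure.pi fun _ : Fin n => P) := by
  have h := ent_tensor P n (fun x => l * Y x) (fun i x => l * Yi i x) ((BM.const l).mul hY)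
    (fun i => (BM.const l).mul (hYi i)) (fun i x s => by rw [hi])
  rw [Finset.mul_sum]
  have e : ∫ x, l * Y x * exp (l * Y x) ∂(Measure.pi fun _ : Fin n => P) =
      l * ∫ x, Y x * exp (l * Y x) ∂(Measure.pi fun _ : Fin n => P) := by
    rw [← integral_const_mul]
    simp_rw [mul_assoc]
  rw [e] at h
  refine h.trans (Finset.sum_le_sum fun i _ => ?_)
  rw [← integral_const_mul]
  have bY := (BM.const l).mul hY
  have bYi := (BM.const l).mul (hYi i)
  apply integral_mono
  · exact (((bY.exp.mul (bY.sub bYi)).sub bY.exp).add bYi.exp).integrable _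
  · have b2 := hY.sub (hYi i)
    have := ((BM.const (l^2)).mul ((b2.mul b2).mul bY.exp)).integrable (Measure.pi fun _ : Fin n => P)
    simpa only [pow_two] using this
  intro x
  have ha : |-(l * (Y x - Yi i x))| ≤ 1 := by
    rw [abs_neg, abs_mul, abs_of_pos hl]
    calc l * |Y x - Yi i x| ≤ 1 * 1 := mul_le_mul hl1 (h1 i x) (abs_nonneg _) zero_le_one
      _ = 1 := one_mul 1
  have hb := (abs_le.1 (Real.abs_exp_sub_one_sub_id_le ha)).2
  have he : exp (l * Yi i x) = exp (l * Y x) * exp (-(l * (Y x - Yi i x))) := by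
    rw [← exp_add]; ring_nf
  simp only []
  rw [he]
  have := mul_le_mul_of_nonneg_left hb (exp_pos (l * Y x)).le
  nlinarith [this]

theorem self_bounding {S : Type*} [MeasurableSpace S] (P : Measure S) [IsProbabilityMeasure P]
    (n : ℕ) {Z : (Fin n → S) → ℝ} {Zi : Fin n → (Fin n → S) → ℝ} (hZ : BM Z)
    (hZi : ∀ i, BM (Zi i)) (hi : ∀ i x s, Zi i (Function.update x i s) = Zi i x)
    (h0 : ∀ i x, Zi i x ≤ Z x) (h1 : ∀ i x, Z x ≤ Zi i x + 1)
    (hs : ∀ x, ∑ i, (Z x - Zi i x) ≤ Z x) (η : ℝ) (hη : η ^ 2 = 1)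
    (l : ℝ) (hl : 0 < l) (hl1 : l ≤ 1) :
    cgf (fun x => η * Z x) (Measure.pi fun _ : Fin n => P) l / l
      - η * cgf (fun x => η * Z x) (Measure.pi fun _ : Fin n => P) l ≤
      η * ∫ x, Z x ∂(Measure.pi fun _ : Fin n => P) := by
  set μ := Measure.pi fun _ : Fin n => P
  have bY : BM (fun x => η * Z x) := (BM.const η).mul hZ
  have hη1 : |η| = 1 := by
    rw [← sq_eq_sq₀ (abs_nonneg _) zero_le_one, sq_abs, hη, one_pow]
  have := herbst μ bY η 0 ?_ l hl hl1
  · rw [integral_const_mul] at this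
    linarith
  intro l hl hl1
  refine (ent_bound P n bY (Yi := fun i x => η * Zi i x) (fun i => (BM.const η).mul (hZi i))
    (fun i x s => by rw [hi]) ?_ l hl hl1).trans ?_
  · intro i x
    rw [← mul_sub, abs_mul, hη1, one_mul, abs_of_nonneg (sub_nonneg.2 (h0 i x))]
    linarith [h1 i x]
  apply mul_le_mul_of_nonneg_left _ (sq_nonneg l)
  have bE : BM (fun x => exp (l * (η * Z x))) := ((BM.const l).mul bY).exp
  have bS : ∀ i, BM (fun x => (η * Z x - η * Zi i x) ^ 2 * exp (l * (η * Z x))) := by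
    intro i
    have b2 := bY.sub ((BM.const η).mul (hZi i))
    simpa only [pow_two] using (b2.mul b2).mul bE
  rw [← integral_finsetSum _ (fun i _ => (bS i).integrable _), ← integral_const_mul, zero_mul,
    add_zero]
  apply integral_mono ((BM.sum _ bS).integrable _)
    (((BM.const η).mul (bY.mul bE)).integrable _)
  intro x
  simp only []
  rw [← Finset.sum_mul, ← mul_assoc η (η * Z x)]
  apply mul_le_mul_of_nonneg_right _ (exp_pos _).le
  calc ∑ i, (η * Z x - η * Zi i x) ^ 2 ≤ ∑ i, (Z x - Zi i x) := by
        apply Finset.sum_le_sum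
        intro i _
        have : (η * Z x - η * Zi i x) ^ 2 = (Z x - Zi i x) ^ 2 := by
          rw [← mul_sub, mul_pow, hη, one_mul]
        rw [this]
        nlinarith [h0 i x, h1 i x]
    _ ≤ Z x := hs x
    _ = η * (η * Z x) := by rw [← mul_assoc, ← pow_two, hη, one_mul]

theorem sb_upper {S : Type*} [MeasurableSpace S] (P : Measure S) [IsProbabilityMeasure P]
    (n : ℕ) {Z : (Fin n → S) → ℝ} {Zi : Fin n → (Fin n → S) → ℝ} (hZ : BM Z)
    (hZi : ∀ i, BM (Zi i)) (hi : ∀ i x s, Zi i (Function.update x i s) = Zi i x)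
    (h0 : ∀ i x, Zi i x ≤ Z x) (h1 : ∀ i x, Z x ≤ Zi i x + 1)
    (hs : ∀ x, ∑ i, (Z x - Zi i x) ≤ Z x) (u : ℝ) :
    (Measure.pi fun _ : Fin n => P).real {x | u ≤ Z x} ≤
      exp (∫ x, Z x ∂(Measure.pi fun _ : Fin n => P) - u / 2) := by
  have h := self_bounding P n hZ hZi hi h0 h1 hs 1 (by norm_num) (1/2) (by norm_num) (by norm_num)
  simp only [one_mul] at h
  have h2 := measure_ge_le_exp_cgf (μ := Measure.pi fun _ : Fin n => P) (X := Z) (t := 1/2) u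
    (by norm_num) ((((BM.const (1/2)).mul hZ).exp).integrable _)
  refine h2.trans (exp_le_exp.2 ?_)
  linarith

theorem sb_lower {S : Type*} [MeasurableSpace S] (P : Measure S) [IsProbabilityMeasure P]
    (n : ℕ) {Z : (Fin n → S) → ℝ} {Zi : Fin n → (Fin n → S) → ℝ} (hZ : BM Z)
    (hZi : ∀ i, BM (Zi i)) (hi : ∀ i x s, Zi i (Function.update x i s) = Zi i x)
    (h0 : ∀ i x, Zi i x ≤ Z x) (h1 : ∀ i x, Z x ≤ Zi i x + 1)
    (hs : ∀ x, ∑ i, (Z x - Zi i x) ≤ Z x) (u : ℝ) :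
    (Measure.pi fun _ : Fin n => P).real {x | Z x ≤ u} ≤
      exp (u - (∫ x, Z x ∂(Measure.pi fun _ : Fin n => P)) / 2) := by
  have h := self_bounding P n hZ hZi hi h0 h1 hs (-1) (by norm_num) 1 (by norm_num) (by norm_num)
  have h2 := measure_ge_le_exp_cgf (μ := Measure.pi fun _ : Fin n => P) (X := fun x => -1 * Z x)
    (t := 1) (-u)
    (by norm_num) ((((BM.const 1).mul ((BM.const (-1)).mul hZ)).exp).integrable _)
  have e : {x : Fin n → S | Z x ≤ u} = {x | -u ≤ -1 * Z x} := by
    ext x; simp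
  rw [e]
  refine h2.trans (exp_le_exp.2 ?_)
  linarith



theorem mp_update {S : Type*} [MeasurableSpace S] (P : Measure S) [IsProbabilityMeasure P]
    (n : ℕ) (i : Fin n) :
    MeasurePreserving (fun z : (Fin n → S) × S => Function.update z.1 i z.2)
      ((Measure.pi fun _ : Fin n => P).prod P) (Measure.pi fun _ : Fin n => P) := by
  have hm : Measurable (fun z : (Fin n → S) × S => Function.update z.1 i z.2) := by
    rw [measurable_pi_iff]
    intro k
    by_cases hk : k = i
    · subst hk; simpa using measurable_snd
    · simp only [Function.update_of_ne hk]
      exact (measurable_pi_apply k).comp measurable_fst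
  refine ⟨hm, ?_⟩
  symm
  apply Measure.pi_eq
  intro A hA
  rw [Measure.map_apply hm (MeasurableSet.univ_pi hA)]
  have : (fun z : (Fin n → S) × S => Function.update z.1 i z.2) ⁻¹' (univ.pi A) =
      (univ.pi (Function.update A i univ)) ×ˢ (A i) := by
    ext ⟨x, s⟩
    simp only [mem_preimage, mem_pi, mem_univ, true_implies, mem_prod]
    constructor
    · intro h
      refine ⟨fun k => ?_, by simpa using h i⟩
      by_cases hk : k = i
      · subst hk; simp
      · simpa [Function.update_of_ne hk] using h k
    · rintro ⟨h, hs⟩ k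
      by_cases hk : k = i
      · subst hk; simpa using hs
      · simpa [Function.update_of_ne hk] using h k
  rw [this, Measure.prod_prod, Measure.pi_pi, ← Finset.prod_erase_mul _ _ (Finset.mem_univ i),
    ← Finset.prod_erase_mul _ (fun k => P (A k)) (Finset.mem_univ i)]
  simp only [Function.update_self, measure_univ, mul_one]
  congr 1
  apply Finset.prod_congr rfl
  intro k hk
  rw [Function.update_of_ne (Finset.ne_of_mem_erase hk)]

theorem resample {S : Type*} [MeasurableSpace S] (P : Measure S) [IsProbabilityMeasure P]
    (n : ℕ) (i : Fin n) {g : (Fin n → S) → ℝ} (hg : BM g) :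
    ∫ x, g x ∂(Measure.pi fun _ : Fin n => P) =
      ∫ x, ∫ s, g (Function.update x i s) ∂P ∂(Measure.pi fun _ : Fin n => P) := by
  have h := mp_update P n i
  rw [← integral_prod (fun z : (Fin n → S) × S => g (Function.update z.1 i z.2))
    ((hg.comp h.measurable).integrable _)]
  conv_lhs => rw [← h.map_eq]
  rw [integral_map h.measurable.aemeasurable hg.1.aestronglyMeasurable]

theorem le_iS {ι : Type*} [Finite ι] (f : ι → ℝ) (j : ι) : f j ≤ ⨆ j, f j :=
  le_ciSup (Finite.bddAbove_range f) j

theorem sum_upd {S : Type*} {n : ℕ} (i : Fin n) (x : Fin n → S) (s : S) (g : Fin n → S → ℝ) :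
    ∑ k, g k (Function.update x i s k) = (∑ k ∈ Finset.univ.erase i, g k (x k)) + g i s := by
  rw [← Finset.sum_erase_add _ _ (Finset.mem_univ i)]
  simp only [Function.update_self]
  congr 1
  apply Finset.sum_congr rfl
  intro k hk
  rw [Function.update_of_ne (Finset.ne_of_mem_erase hk)]

theorem sum_erase_upd {S : Type*} {n : ℕ} (i : Fin n) (x : Fin n → S) (s : S)
    (g : Fin n → S → ℝ) :
    ∑ k ∈ Finset.univ.erase i, g k (Function.update x i s k) =
      ∑ k ∈ Finset.univ.erase i, g k (x k) := by
  apply Finset.sum_congr rfl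
  intro k hk
  rw [Function.update_of_ne (Finset.ne_of_mem_erase hk)]

section fam
variable {S : Type*} [MeasurableSpace S] (P : Measure S) [IsProbabilityMeasure P]
  (n : ℕ) {ι : Type*} [Finite ι] [Nonempty ι] (h : ι → S → ℝ)

theorem BM_eval {f : S → ℝ} (hf : BM f) (k : Fin n) : BM (fun x : Fin n → S => f (x k)) :=
  hf.comp (measurable_pi_apply k)

theorem lower_dev (hh : ∀ j, BM (h j)) (h01 : ∀ j s, h j s ∈ Icc (0:ℝ) 1) (r : ℝ)
    (hr : ∀ j, ∫ s, h j s ∂P ≤ r) (u l : ℝ) (hl : 0 < l) (hl1 : l ≤ 1) :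
    (Measure.pi fun _ : Fin n => P).real {x | u ≤ ⨆ j, ∑ i, (∫ s, h j s ∂P - h j (x i))} ≤
      exp (l * (∫ x, ⨆ j, ∑ i, (∫ s, h j s ∂P - h j (x i)) ∂(Measure.pi fun _ : Fin n => P))
        + 2 * n * r * l ^ 2 - l * u) := by
  set μ := Measure.pi fun _ : Fin n => P with hμ
  set p : ι → ℝ := fun j => ∫ s, h j s ∂P with hp
  have hp0 : ∀ j, 0 ≤ p j := fun j => integral_nonneg fun s => (h01 j s).1
  have hp1 : ∀ j, p j ≤ 1 := by
    intro j
    have : p j ≤ ∫ s, (1:ℝ) ∂P :=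
      integral_mono ((hh j).integrable _) (integrable_const _) fun s => (h01 j s).2
    simpa using this
  have hr0 : 0 ≤ r := (hp0 (Classical.arbitrary ι)).trans (hr _)
  set Y : (Fin n → S) → ℝ := fun x => ⨆ j, ∑ i, (p j - h j (x i)) with hY
  set Yi : Fin n → (Fin n → S) → ℝ := fun i x => ⨆ j, ∑ k ∈ Finset.univ.erase i, (p j - h j (x k))
    with hYi
  have bY : BM Y := BM.iSup fun j => BM.sum _ fun k => (BM.const _).sub (BM_eval n (hh j) k)
  have bYi : ∀ i, BM (Yi i) := fun i =>
    BM.iSup fun j => BM.sum _ fun k => (BM.const _).sub (BM_eval n (hh j) k)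
  have hind : ∀ i x s, Yi i (Function.update x i s) = Yi i x := by
    intro i x s
    simp only [hYi]
    congr 1
    ext j
    exact sum_erase_upd i x s (fun _ y => p j - h j y)
  -- upper bound of Y
  have hup : ∀ i x, ∃ j, Y x ≤ Yi i x + (p j - h j (x i)) := by
    intro i x
    obtain ⟨j, hj⟩ := exists_eq_ciSup_of_finite (f := fun j => ∑ i, (p j - h j (x i)))
    refine ⟨j, ?_⟩
    have := le_iS (fun j => ∑ k ∈ Finset.univ.erase i, (p j - h j (x k))) j
    simp only [hY, ← hj]
    rw [← Finset.sum_erase_add _ _ (Finset.mem_univ i)]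
    simp only [hYi]
    linarith
  have hlo : ∀ i x, ∃ j, ∀ s, Yi i x + (p j - h j s) ≤ Y (Function.update x i s) := by
    intro i x
    obtain ⟨j, hj⟩ := exists_eq_ciSup_of_finite
      (f := fun j => ∑ k ∈ Finset.univ.erase i, (p j - h j (x k)))
    refine ⟨j, fun s => ?_⟩
    have := le_iS (fun j => ∑ k, (p j - h j (Function.update x i s k))) j
    rw [sum_upd i x s (fun _ y => p j - h j y)] at this
    simp only [hYi, ← hj, hY]
    exact this
  have habs : ∀ i x, |Y x - Yi i x| ≤ 1 := by
    intro i x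
    rw [abs_le]
    obtain ⟨j, hj⟩ := hup i x
    obtain ⟨j', hj'⟩ := hlo i x
    have := hj' (x i)
    rw [Function.update_eq_self] at this
    have a1 := (h01 j (x i)).1
    have a2 := (h01 j' (x i)).2
    have a3 := hp0 j'
    have a4 := hp1 j
    constructor <;> linarith
  have key : ∀ l : ℝ, 0 < l → l ≤ 1 → ∀ i, ∫ x, (Y x - Yi i x) ^ 2 * exp (l * Y x) ∂μ ≤
      2 * r * ∫ x, exp (l * Y x) ∂μ := by
    intro l hl hl1 i
    have bE : BM (fun x => exp (l * Y x)) := ((BM.const l).mul bY).exp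
    have bD : BM (fun x => (Y x - Yi i x) ^ 2 * exp (l * Y x)) := by
      have b2 := bY.sub (bYi i)
      simpa only [pow_two] using (b2.mul b2).mul bE
    have hmu := (mp_update P n i).measurable
    rw [resample P n i bD, resample P n i bE, ← integral_const_mul]
    apply integral_mono ((bD.comp hmu).intg P |>.integrable _)
      (((BM.const _).mul ((bE.comp hmu).intg P)).integrable _)
    intro x
    have hms : Measurable (fun s => Function.update x i s) := measurable_update x
    obtain ⟨j, hj⟩ := hlo i x
    simp only [hind]
    set c := Yi i x
    have e1 : ∫ s, (Y (Function.update x i s) - c) ^ 2 * exp (l * Y (Function.update x i s)) ∂P ≤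
        ∫ s, (r * exp (l * Y (Function.update x i s)) + h j s * exp (l * c)) ∂P := by
      apply integral_mono
      · have b2 := (bY.comp hms).sub (BM.const c)
        have := ((b2.mul b2).mul (bE.comp hms)).integrable P
        simpa only [pow_two] using this
      · exact (((BM.const r).mul (bE.comp hms)).add ((hh j).mul (BM.const _))).integrable P
      intro s
      simp only []
      set y := Y (Function.update x i s) with hy
      have hE1 := exp_pos (l * y)
      have hE2 := exp_pos (l * c)
      have hab := habs i (Function.update x i s)
      rw [hind, ← hy, abs_le] at hab
      rcases le_total c y with hcy | hcy
      · obtain ⟨j', hj'⟩ := hup i (Function.update x i s)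
        rw [hind, ← hy, Function.update_self] at hj'
        have a1 := (h01 j' s).1
        have a2 := hr j'
        have a3 : (y - c) ^ 2 ≤ r := by
          have : y - c ≤ r := by linarith
          nlinarith [hab.2]
        have a4 : 0 ≤ h j s * exp (l * c) := mul_nonneg (h01 j s).1 hE2.le
        nlinarith
      · have a1 := hj s
        have a5 := hp0 j
        rw [← hy] at a1
        have a2 : (y - c) ^ 2 ≤ h j s := by
          nlinarith [hab.1]
        have a3 : exp (l * y) ≤ exp (l * c) := exp_le_exp.2 (by nlinarith)
        have a4 : (y - c) ^ 2 * exp (l * y) ≤ h j s * exp (l * c) :=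
          mul_le_mul a2 a3 hE1.le (h01 j s).1
        nlinarith
    have e2 : exp (l * c) ≤ ∫ s, exp (l * Y (Function.update x i s)) ∂P := by
      have : ∫ s, exp (l * c) * (1 + l * (p j - h j s)) ∂P ≤
          ∫ s, exp (l * Y (Function.update x i s)) ∂P := by
        apply integral_mono
        · exact ((BM.const _).mul ((BM.const _).add ((BM.const _).mul
            ((BM.const _).sub (hh j))))).integrable P
        · exact (bE.comp hms).integrable P
        intro s
        have a1 := hj s
        have a2 := Real.add_one_le_exp (l * (p j - h j s))
        have a3 : exp (l * (c + (p j - h j s))) ≤ exp (l * Y (Function.update x i s)) :=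
          exp_le_exp.2 (by nlinarith)
        rw [mul_add, exp_add] at a3
        have a4 := exp_pos (l * c)
        simp only []
        nlinarith
      rw [integral_const_mul, integral_add (integrable_const _)
        (((BM.const l).mul ((BM.const _).sub (hh j))).integrable P), integral_const_mul,
        integral_sub (integrable_const _) ((hh j).integrable P)] at this
      simpa [hp] using this
    rw [integral_add (((BM.const r).mul (bE.comp hms)).integrable P)
      (((hh j).mul (BM.const _)).integrable P), integral_const_mul, integral_mul_const] at e1
    have e3 : (∫ s, h j s ∂P) * exp (l * c) ≤ r * ∫ s, exp (l * Y (Function.update x i s)) ∂P :=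
      mul_le_mul (hr j) e2 (exp_pos _).le hr0
    linarith
  have hH := herbst μ bY 0 (2 * n * r) (by
    intro l hl hl1
    refine (ent_bound P n bY bYi hind habs l hl hl1).trans ?_
    apply mul_le_mul_of_nonneg_left _ (sq_nonneg l)
    refine (Finset.sum_le_sum fun i _ => key l hl hl1 i).trans ?_
    simp
    apply le_of_eq; ring) l hl hl1
  have h2 := measure_ge_le_exp_cgf (μ := μ) (X := Y) (t := l) u hl.le
    ((((BM.const l).mul bY).exp).integrable _)
  refine h2.trans (exp_le_exp.2 ?_)
  have h3 : cgf Y μ l / l ≤ ∫ x, Y x ∂μ + 2 * n * r * l := by linarith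
  rw [div_le_iff₀ hl] at h3
  nlinarith

/-- Random-sign supremum. -/
def Tsup (σ : Fin n → Bool) (x : Fin n → S) : ℝ := ⨆ j, |∑ k, radSign (σ k) * h j (x k)|

theorem BM_T (hh : ∀ j, BM (h j)) (σ : Fin n → Bool) : BM (Tsup n h σ) :=
  BM.iSup fun j => (BM.sum _ fun k => (BM.const _).mul (BM_eval n (hh j) k)).abs

/-- Coordinatewise swap. -/
def swp (σ : Fin n → Bool) (z : (Fin n → S) × (Fin n → S)) : (Fin n → S) × (Fin n → S) :=
  (fun i => if σ i then z.1 i else z.2 i, fun i => if σ i then z.2 i else z.1 i)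

theorem mp_swp (σ : Fin n → Bool) : MeasurePreserving (swp (S := S) n σ)
    ((Measure.pi fun _ : Fin n => P).prod (Measure.pi fun _ : Fin n => P))
    ((Measure.pi fun _ : Fin n => P).prod (Measure.pi fun _ : Fin n => P)) := by
  have e := measurePreserving_arrowProdEquivProdArrow S S (Fin n) (fun _ => P) (fun _ => P)
  have f : MeasurePreserving (fun (a : Fin n → S × S) i => (if σ i then id else Prod.swap) (a i))
      (Measure.pi fun _ : Fin n => P.prod P) (Measure.pi fun _ : Fin n => P.prod P) := by
    refine measurePreserving_pi (fun _ => P.prod P) (fun _ => P.prod P)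
      (f := fun i => if σ i then id else Prod.swap) ?_
    intro i
    by_cases hi : σ i
    · simp only [hi, if_true]; exact MeasurePreserving.id _
    · simp only [hi]; exact Measure.measurePreserving_swap
  have g := (e.comp f).comp (e.symm _)
  convert g using 1
  ext z i
  · by_cases hi : σ i <;> simp [swp, hi, MeasurableEquiv.arrowProdEquivProdArrow, Equiv.arrowProdEquivProdArrow]
  · by_cases hi : σ i <;> simp [swp, hi, MeasurableEquiv.arrowProdEquivProdArrow, Equiv.arrowProdEquivProdArrow]

theorem integral_ev {f : S → ℝ} (hf : BM f) (k : Fin n) :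
    ∫ x, f (x k) ∂(Measure.pi fun _ : Fin n => P) = ∫ s, f s ∂P := by
  have := measurePreserving_eval (fun _ : Fin n => P) k
  conv_rhs => rw [← this.map_eq]
  rw [integral_map this.measurable.aemeasurable hf.1.aestronglyMeasurable]

theorem symmetrization (hh : ∀ j, BM (h j)) (σ : Fin n → Bool) :
    ∫ x, ⨆ j, |∑ i, (∫ s, h j s ∂P - h j (x i))| ∂(Measure.pi fun _ : Fin n => P) ≤
      2 * ∫ x, Tsup n h σ x ∂(Measure.pi fun _ : Fin n => P) := by
  set μ := Measure.pi fun _ : Fin n => P with hμ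
  set G : (Fin n → S) × (Fin n → S) → ℝ := fun z => ⨆ j, |∑ i, (h j (z.2 i) - h j (z.1 i))| with hG
  have bG : BM G := BM.iSup fun j => (BM.sum _ fun k =>
    ((BM_eval n (hh j) k).comp measurable_snd).sub ((BM_eval n (hh j) k).comp measurable_fst)).abs
  have bT := BM_T n h hh σ
  have s1 : ∫ x, ⨆ j, |∑ i, (∫ s, h j s ∂P - h j (x i))| ∂μ ≤ ∫ x, ∫ y, G (x, y) ∂μ ∂μ := by
    apply integral_mono
    · exact (BM.iSup fun j => (BM.sum _ fun k =>
        (BM.const _).sub (BM_eval n (hh j) k)).abs).integrable _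
    · exact (bG.intg μ).integrable _
    intro x
    apply ciSup_le
    intro j
    have bs : ∀ k : Fin n, BM (fun y : Fin n → S => h j (y k) - h j (x k)) := fun k =>
      (BM_eval n (hh j) k).sub (BM.const _)
    have : ∑ i, (∫ s, h j s ∂P - h j (x i)) = ∫ y, ∑ i, (h j (y i) - h j (x i)) ∂μ := by
      rw [integral_finsetSum _ fun i _ => (bs i).integrable _]
      apply Finset.sum_congr rfl
      intro i _
      rw [integral_sub ((BM_eval n (hh j) i).integrable _) (integrable_const _),
        integral_ev P n (hh j) i]
      simp
    rw [this]
    refine (abs_integral_le_integral_abs).trans ?_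
    apply integral_mono ((BM.sum _ bs).abs.integrable _)
      ((bG.comp measurable_prodMk_left).integrable _)
    intro y
    exact le_iS (fun j => |∑ i, (h j (y i) - h j (x i))|) j
  refine s1.trans ?_
  rw [← integral_prod G (bG.integrable _)]
  have hs := mp_swp P n σ
  have s2 : ∫ z, G z ∂(μ.prod μ) = ∫ z, G (swp n σ z) ∂(μ.prod μ) := by
    conv_lhs => rw [← hs.map_eq]
    rw [integral_map hs.measurable.aemeasurable bG.1.aestronglyMeasurable]
  rw [s2]
  have b3 : BM (fun z : (Fin n → S) × (Fin n → S) => Tsup n h σ z.1 + Tsup n h σ z.2) :=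
    (bT.comp measurable_fst).add (bT.comp measurable_snd)
  have s3 : ∫ z, G (swp n σ z) ∂(μ.prod μ) ≤ ∫ z, (Tsup n h σ z.1 + Tsup n h σ z.2) ∂(μ.prod μ) := by
    apply integral_mono ((bG.comp hs.measurable).integrable _) (b3.integrable _)
    intro z
    apply ciSup_le
    intro j
    have : ∑ i, (h j ((swp n σ z).2 i) - h j ((swp n σ z).1 i)) =
        (∑ i, radSign (σ i) * h j (z.2 i)) - ∑ i, radSign (σ i) * h j (z.1 i) := by
      rw [← Finset.sum_sub_distrib]
      apply Finset.sum_congr rfl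
      intro i _
      by_cases hi : σ i <;> simp [swp, hi, radSign]; ring
    rw [this]
    refine (abs_sub _ _).trans ?_
    rw [add_comm]
    exact add_le_add (le_iS (fun j => |∑ i, radSign (σ i) * h j (z.1 i)|) j)
      (le_iS (fun j => |∑ i, radSign (σ i) * h j (z.2 i)|) j)
  refine s3.trans ?_
  rw [integral_prod _ (b3.integrable _)]
  have : ∀ x : Fin n → S, ∫ y, (Tsup n h σ x + Tsup n h σ y) ∂μ = Tsup n h σ x + ∫ y, Tsup n h σ y ∂μ := by
    intro x
    rw [integral_add (integrable_const _) (bT.integrable _)]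
    simp
  simp only [this]
  rw [integral_add (bT.integrable _) (integrable_const _)]
  simp
  linarith

end fam



section fam2
variable {S : Type*} [MeasurableSpace S] (P : Measure S) [IsProbabilityMeasure P]
  (n : ℕ) {ι : Type*} [Finite ι] [Nonempty ι] (h : ι → S → ℝ)

theorem Z_upper (hh : ∀ j, BM (h j)) (h01 : ∀ j s, h j s ∈ Icc (0:ℝ) 1) (u : ℝ) :
    (Measure.pi fun _ : Fin n => P).real {x | u ≤ ⨆ j, ∑ k, h j (x k)} ≤
      exp (∫ x, ⨆ j, ∑ k, h j (x k) ∂(Measure.pi fun _ : Fin n => P) - u / 2) := by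
  have hopt : ∀ x : Fin n → S, ∃ j, (⨆ j, ∑ k, h j (x k)) = ∑ k, h j (x k) ∧ ∀ i,
      (⨆ j, ∑ k, h j (x k)) ≤ (⨆ j, ∑ k ∈ Finset.univ.erase i, h j (x k)) + h j (x i) := by
    intro x
    obtain ⟨j, hj⟩ := exists_eq_ciSup_of_finite (f := fun j => ∑ k, h j (x k))
    refine ⟨j, hj.symm, fun i => ?_⟩
    rw [← hj, ← Finset.sum_erase_add _ _ (Finset.mem_univ i)]
    have := le_iS (fun j => ∑ k ∈ Finset.univ.erase i, h j (x k)) j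
    linarith
  refine sb_upper P n (Z := fun x => ⨆ j, ∑ k, h j (x k))
    (Zi := fun i x => ⨆ j, ∑ k ∈ Finset.univ.erase i, h j (x k))
    (BM.iSup fun j => BM.sum _ fun k => BM_eval n (hh j) k)
    (fun i => BM.iSup fun j => BM.sum _ fun k => BM_eval n (hh j) k) ?_ ?_ ?_ ?_ u
  · intro i x s
    congr 1
    ext j
    exact sum_erase_upd i x s (fun _ y => h j y)
  · intro i x
    apply ciSup_le
    intro j
    have := le_iS (fun j => ∑ k, h j (x k)) j
    rw [← Finset.sum_erase_add _ _ (Finset.mem_univ i)] at this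
    have := (h01 j (x i)).1
    linarith
  · intro i x
    obtain ⟨j, _, hj⟩ := hopt x
    have := hj i
    have := (h01 j (x i)).2
    linarith
  · intro x
    obtain ⟨j, hj0, hj⟩ := hopt x
    conv_rhs => rw [hj0]
    apply Finset.sum_le_sum
    intro i _
    linarith [hj i]

/-- flip of coordinate. -/
def flp (i : Fin n) : (Fin n → Bool) ≃ (Fin n → Bool) :=
  Function.Involutive.toPerm (fun σ => Function.update σ i (!σ i)) (by
    intro σ
    simp)

/-- averaged random-sign supremum -/
def Wav (x : Fin n → S) : ℝ := (∑ σ : Fin n → Bool, Tsup n h σ x) / 2 ^ n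

theorem abs_radSign_le (b : Bool) (y : ℝ) (hy : y ∈ Icc (0:ℝ) 1) : |radSign b * y| ≤ 1 := by
  cases b <;> simp [radSign, abs_of_nonneg hy.1, hy.2]

theorem BM_W (hh : ∀ j, BM (h j)) : BM (Wav n h) := by
  have := (BM.sum Finset.univ fun σ => BM_T n h hh σ).mul (BM.const ((2:ℝ)^n)⁻¹)
  have e : Wav n h = fun x => (∑ σ : Fin n → Bool, Tsup n h σ x) * ((2:ℝ) ^ n)⁻¹ := by
    ext x; simp only [Wav, div_eq_mul_inv]
  rw [e]
  exact this

theorem W_lower (hh : ∀ j, BM (h j)) (h01 : ∀ j s, h j s ∈ Icc (0:ℝ) 1) (u : ℝ) :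
    (Measure.pi fun _ : Fin n => P).real {x | Wav n h x ≤ u} ≤
      exp (u - (∫ x, Wav n h x ∂(Measure.pi fun _ : Fin n => P)) / 2) := by
  set Ti : Fin n → (Fin n → Bool) → (Fin n → S) → ℝ := fun i σ x =>
    ⨆ j, |∑ k ∈ Finset.univ.erase i, radSign (σ k) * h j (x k)| with hTi
  have bTi : ∀ i σ, BM (Ti i σ) := fun i σ =>
    BM.iSup fun j => (BM.sum _ fun k => (BM.const _).mul (BM_eval n (hh j) k)).abs
  have h2 : (0:ℝ) < 2 ^ n := by positivity
  have hcard : (∑ _σ : Fin n → Bool, (1:ℝ)) = 2 ^ n := by simp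
  refine sb_lower P n (Z := Wav n h)
    (Zi := fun i x => (∑ σ : Fin n → Bool, Ti i σ x) / 2 ^ n) (BM_W n h hh) ?_ ?_ ?_ ?_ ?_ u
  · intro i
    have := (BM.sum Finset.univ fun σ => bTi i σ).mul (BM.const ((2:ℝ)^n)⁻¹)
    simpa only [div_eq_mul_inv] using this
  · intro i x s
    simp only [hTi]
    congr 1
    apply Finset.sum_congr rfl
    intro σ _
    congr 1
    ext j
    congr 1
    exact sum_erase_upd i x s (fun k y => radSign (σ k) * h j y)
  · intro i x
    simp only [Wav]
    apply div_le_div_of_nonneg_right _ h2.le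
    have e : ∑ σ, Tsup n h σ x = ∑ σ, Tsup n h (flp n i σ) x :=
      ((flp n i).sum_comp (fun σ => Tsup n h σ x)).symm
    have e2 : ∑ σ, Ti i σ x ≤ ∑ σ, (Tsup n h σ x + Tsup n h (flp n i σ) x) / 2 := by
      apply Finset.sum_le_sum
      intro σ _
      apply ciSup_le
      intro j
      have a1 := le_iS (fun j => |∑ k, radSign (σ k) * h j (x k)|) j
      have a2 := le_iS (fun j => |∑ k, radSign (flp n i σ k) * h j (x k)|) j
      have a3 : ∑ k, radSign (flp n i σ k) * h j (x k) =
          (∑ k ∈ Finset.univ.erase i, radSign (σ k) * h j (x k)) - radSign (σ i) * h j (x i) := by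
        rw [← Finset.sum_erase_add _ _ (Finset.mem_univ i), sub_eq_add_neg]
        congr 1
        · apply Finset.sum_congr rfl
          intro k hk
          have : flp n i σ k = σ k := by
            show Function.update σ i (!σ i) k = σ k
            rw [Function.update_of_ne (Finset.ne_of_mem_erase hk)]
          rw [this]
        · have : flp n i σ i = !σ i := by
            show Function.update σ i (!σ i) i = _
            rw [Function.update_self]
          rw [this]
          cases σ i <;> simp [radSign]
      rw [a3] at a2
      rw [← Finset.sum_erase_add _ _ (Finset.mem_univ i)] at a1
      set A := ∑ k ∈ Finset.univ.erase i, radSign (σ k) * h j (x k)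
      set b := radSign (σ i) * h j (x i)
      have a4 : |A| ≤ (|A + b| + |A - b|) / 2 := by
        have := abs_add_le (A + b) (A - b)
        have e : A + b + (A - b) = 2 * A := by ring
        rw [e, abs_mul, abs_two] at this
        linarith
      simp only [Tsup]
      linarith
    rw [← Finset.sum_div, Finset.sum_add_distrib, ← e] at e2
    linarith
  · intro i x
    simp only [Wav]
    rw [div_le_iff₀ h2, add_mul, div_mul_cancel₀ _ h2.ne', ← hcard, Finset.mul_sum,
      ← Finset.sum_add_distrib]
    apply Finset.sum_le_sum
    intro σ _
    apply ciSup_le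
    intro j
    have a1 := le_iS (fun j => |∑ k ∈ Finset.univ.erase i, radSign (σ k) * h j (x k)|) j
    rw [← Finset.sum_erase_add _ _ (Finset.mem_univ i)]
    have a2 := abs_add_le (∑ k ∈ Finset.univ.erase i, radSign (σ k) * h j (x k))
      (radSign (σ i) * h j (x i))
    have a3 := abs_radSign_le (σ i) _ (h01 j (x i))
    simp only [hTi]
    linarith
  · intro x
    have e : ∀ i, Wav n h x - (∑ σ : Fin n → Bool, Ti i σ x) / 2 ^ n =
        (∑ σ, (Tsup n h σ x - Ti i σ x)) / 2 ^ n := by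
      intro i
      rw [Finset.sum_sub_distrib, sub_div]; rfl
    simp only [e]
    rw [← Finset.sum_div, Finset.sum_comm]
    apply div_le_div_of_nonneg_right _ h2.le
    apply Finset.sum_le_sum
    intro σ _
    obtain ⟨j, hj⟩ := exists_eq_ciSup_of_finite (f := fun j => |∑ k, radSign (σ k) * h j (x k)|)
    have hT : Tsup n h σ x = |∑ k, radSign (σ k) * h j (x k)| := hj.symm
    rw [hT]
    have a0 : ∀ i, |∑ k, radSign (σ k) * h j (x k) - radSign (σ i) * h j (x i)| ≤ Ti i σ x := by
      intro i
      have a1 := le_iS (fun j => |∑ k ∈ Finset.univ.erase i, radSign (σ k) * h j (x k)|) j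
      rw [← Finset.sum_erase_add _ _ (Finset.mem_univ i), add_sub_cancel_right]
      exact a1
    set A := ∑ k, radSign (σ k) * h j (x k) with hA
    rcases le_total 0 A with hA0 | hA0
    · rw [abs_of_nonneg hA0]
      conv_rhs => rw [hA]
      apply Finset.sum_le_sum
      intro i _
      have := le_abs_self (A - radSign (σ i) * h j (x i))
      linarith [a0 i]
    · rw [abs_of_nonpos hA0]
      conv_rhs => rw [hA, ← Finset.sum_neg_distrib]
      apply Finset.sum_le_sum
      intro i _
      have := neg_abs_le (A - radSign (σ i) * h j (x i))
      linarith [a0 i]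

theorem symm_W (hh : ∀ j, BM (h j)) :
    ∫ x, ⨆ j, |∑ i, (∫ s, h j s ∂P - h j (x i))| ∂(Measure.pi fun _ : Fin n => P) ≤
      2 * ∫ x, Wav n h x ∂(Measure.pi fun _ : Fin n => P) := by
  simp only [Wav]
  rw [integral_div, integral_finsetSum _ fun σ _ => (BM_T n h hh σ).integrable _]
  set D := ∫ x, ⨆ j, |∑ i, (∫ s, h j s ∂P - h j (x i))| ∂(Measure.pi fun _ : Fin n => P)
  have h2 : (0:ℝ) < 2 ^ n := by positivity
  have hcard : (∑ _σ : Fin n → Bool, (1:ℝ)) = 2 ^ n := by simp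
  rw [mul_div_assoc', le_div_iff₀ h2, ← hcard, Finset.mul_sum, Finset.mul_sum]
  apply Finset.sum_le_sum
  intro σ _
  rw [mul_one]
  exact symmetrization P n h hh σ

end fam2

theorem integral_rad (n : ℕ) (g : (Fin n → Bool) → ℝ) :
    ∫ σ, g σ ∂(radMeasure n) = (∑ σ, g σ) / 2 ^ n := by
  have hp : IsProbabilityMeasure (radMeasure n) := by
    unfold radMeasure; infer_instance
  rw [integral_fintype Integrable.of_finite, Finset.sum_div]
  apply Finset.sum_congr rfl
  intro σ _
  have : (radMeasure n).real {σ} = ((2:ℝ) ^ n)⁻¹ := by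
    rw [Measure.real, radMeasure, Measure.pi_singleton]
    have : ∀ b : Bool, (PMF.uniformOfFintype Bool).toMeasure {b} = 2⁻¹ := by
      intro b
      rw [PMF.toMeasure_apply_singleton _ _ (measurableSet_singleton b)]
      simp
    simp [this]
  rw [this, smul_eq_mul]
  field_simp



theorem conc_scale {ψ : ℝ → ℝ} (hc : ConcaveOn ℝ (Ici 0) ψ) (h0 : ψ 0 = 0) (l u : ℝ) (hl : 1 ≤ l)
    (hu : 0 ≤ u) : ψ (l * u) ≤ l * ψ u := by
  have hl0 : 0 < l := by linarith
  have h := hc.2 (show l * u ∈ Ici (0:ℝ) from mul_nonneg hl0.le hu)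
    (Set.mem_Ici.2 (le_refl (0:ℝ))) (show (0:ℝ) ≤ l⁻¹ by positivity)
    (show (0:ℝ) ≤ 1 - l⁻¹ from sub_nonneg.2 (inv_le_one_of_one_le₀ hl)) (by ring)
  simp only [smul_eq_mul, mul_zero, add_zero, h0] at h
  rw [inv_mul_cancel_left₀ hl0.ne'] at h
  rw [inv_mul_le_iff₀ hl0] at h
  exact h

theorem psi_le {ψ : ℝ → ℝ} (hc : ConcaveOn ℝ (Ici 0) ψ) (h0 : ψ 0 = 0) {rh : ℝ}
    (hmax : ∀ ρ : ℝ, ρ = ψ (Real.sqrt ρ) → ρ ≤ rh) (r : ℝ) (hr : rh < r) :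
    ψ (Real.sqrt r) ≤ r := by
  have hrh : 0 ≤ rh := hmax 0 (by simp [h0])
  have hr0 : 0 < r := hrh.trans_lt hr
  by_contra! hcon
  set q := max (Real.sqrt r) (max 1 (ψ 1)) with hq
  have hq1 : 1 ≤ q := (le_max_left _ _).trans (le_max_right _ _)
  have hq2 : ψ 1 ≤ q := (le_max_right _ _).trans (le_max_right _ _)
  have hq3 : Real.sqrt r ≤ q := le_max_left _ _
  have hq0 : 0 ≤ q := by linarith
  have hrB : r ≤ q ^ 2 := (Real.sqrt_le_left hq0).1 hq3
  have hcont : ContinuousOn (fun u => ψ (Real.sqrt u) - u) (Icc r (q ^ 2)) := by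
    apply ContinuousOn.sub _ continuousOn_id
    have h1 : ContinuousOn ψ (Ioi 0) :=
      (hc.subset Ioi_subset_Ici_self (convex_Ioi 0)).continuousOn isOpen_Ioi
    exact h1.comp Real.continuous_sqrt.continuousOn
      (fun u hu => Real.sqrt_pos.2 (hr0.trans_le hu.1))
  have hB : ψ (Real.sqrt (q ^ 2)) - q ^ 2 ≤ 0 := by
    rw [Real.sqrt_sq hq0]
    have := conc_scale hc h0 q 1 hq1 zero_le_one
    rw [mul_one] at this
    nlinarith
  have := intermediate_value_Icc' hrB hcont
  obtain ⟨u, hu, hu0⟩ := this (show (0:ℝ) ∈ _ from ⟨hB, by linarith⟩)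
  have := hmax u (by simp only [] at hu0; linarith)
  linarith [hu.1]

theorem psi_le_c {ψ : ℝ → ℝ} (hc : ConcaveOn ℝ (Ici 0) ψ) (h0 : ψ 0 = 0) {rh : ℝ}
    (hmax : ∀ ρ : ℝ, ρ = ψ (Real.sqrt ρ) → ρ ≤ rh) (c ρ : ℝ) (hc0 : 0 < c) (hc1 : c ≤ 1)
    (hr : rh < c ^ 2 * ρ) : ψ (Real.sqrt ρ) ≤ c * ρ := by
  have h1 := psi_le hc h0 hmax _ hr
  rw [Real.sqrt_mul (sq_nonneg c), Real.sqrt_sq hc0.le] at h1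
  have h2 := conc_scale hc h0 c⁻¹ (c * Real.sqrt ρ) ((one_le_inv₀ hc0).2 hc1) (by positivity)
  rw [inv_mul_cancel_left₀ hc0.ne'] at h2
  calc ψ (Real.sqrt ρ) ≤ c⁻¹ * ψ (c * Real.sqrt ρ) := h2
    _ ≤ c⁻¹ * (c ^ 2 * ρ) := mul_le_mul_of_nonneg_left h1 (by positivity)
    _ = c * ρ := by field_simp

theorem dyadic {S : Type*} {n : ℕ} (hn : 0 < n) {ι : Type*} [Finite ι] [Nonempty ι]
    (f : ι → S → ℝ) (h01 : ∀ j s, f j s ∈ Icc (0:ℝ) 1) (a : ι → ℝ) (ha : ∀ j, a j ∈ Icc (0:ℝ) 1)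
    (x : Fin n → S) (ρ : ℝ) (hρ : 0 < ρ) (hem : ∀ j, a j * empMean n x (f j) ≤ ρ)
    {ψ : ℝ → ℝ} (hm : MonotoneOn ψ (Ici 0)) (hc : ConcaveOn ℝ (Ici 0) ψ) (h0 : ψ 0 = 0)
    (hψ : ∀ r : ℝ, 0 ≤ r → radSup n (range f) x r ≤ ψ (Real.sqrt r)) :
    Wav n (fun j s => a j * f j s) x ≤ n * (5 * ψ (Real.sqrt ρ)) := by
  have hn' : (0:ℝ) < n := by exact_mod_cast hn
  set Q : ℝ → (Fin n → Bool) → ℝ := fun u σ =>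
    sSup {b : ℝ | ∃ g ∈ range f, empMean n x g ≤ u ∧ b = |radAvg n x σ g|} with hQ
  have hQle : ∀ u σ j, empMean n x (f j) ≤ u → |radAvg n x σ (f j)| ≤ Q u σ := by
    intro u σ j hj
    apply le_csSup
    · apply (Set.finite_range (fun j => |radAvg n x σ (f j)|)).bddAbove.mono
      rintro b ⟨g, ⟨i, rfl⟩, _, rfl⟩
      exact ⟨i, rfl⟩
    · exact ⟨f j, ⟨j, rfl⟩, hj, rfl⟩
  have hQ0 : ∀ u σ, 0 ≤ Q u σ := by
    intro u σ
    apply Real.sSup_nonneg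
    rintro b ⟨g, _, _, rfl⟩
    exact abs_nonneg _
  have hrad : ∀ u, radSup n (range f) x u = (∑ σ, Q u σ) / 2 ^ n := fun u => integral_rad n _
  have hem1 : ∀ j, empMean n x (f j) ≤ 1 := by
    intro j
    rw [empMean, div_le_one hn']
    calc ∑ i, f j (x i) ≤ ∑ _i : Fin n, (1:ℝ) := Finset.sum_le_sum fun i _ => (h01 j (x i)).2
      _ = n := by simp
  have hψ0 : 0 ≤ ψ (Real.sqrt ρ) := by
    rw [← h0]
    exact hm (Set.mem_Ici.2 (le_refl (0:ℝ))) (Real.sqrt_nonneg ρ) (Real.sqrt_nonneg ρ)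
  obtain ⟨N, hN⟩ : ∃ N : ℕ, 1 ≤ 4 ^ N * ρ := by
    obtain ⟨N, hN⟩ := pow_unbounded_of_one_lt (1 / ρ) (by norm_num : (1:ℝ) < 4)
    exact ⟨N, by rw [div_lt_iff₀ hρ] at hN; exact hN.le⟩
  have hpt : ∀ σ, Tsup n (fun j s => a j * f j s) σ x ≤
      n * (Q ρ σ + ∑ k ∈ Finset.range N, (1/4:ℝ) ^ k * Q (4 ^ (k+1) * ρ) σ) := by
    intro σ
    apply ciSup_le
    intro j
    have e1 : ∑ k, radSign (σ k) * (a j * f j (x k)) = n * (a j * radAvg n x σ (f j)) := by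
      rw [radAvg]
      field_simp
      rw [Finset.mul_sum]
      apply Finset.sum_congr rfl
      intro k _; ring
    rw [e1, abs_mul, abs_of_pos hn', abs_mul, abs_of_nonneg (ha j).1]
    apply mul_le_mul_of_nonneg_left _ hn'.le
    have hterm : ∀ k ∈ Finset.range N, 0 ≤ (1/4:ℝ) ^ k * Q (4 ^ (k+1) * ρ) σ := fun k _ =>
      mul_nonneg (by positivity) (hQ0 _ _)
    by_cases hj : empMean n x (f j) ≤ ρ
    · have h1 := hQle ρ σ j hj
      have h2 := mul_le_of_le_one_left (abs_nonneg (radAvg n x σ (f j))) (ha j).2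
      have h3 := Finset.sum_nonneg hterm
      linarith
    · have hex : ∃ k : ℕ, empMean n x (f j) ≤ 4 ^ k * ρ := ⟨N, (hem1 j).trans hN⟩
      classical
      have hs := Nat.find_spec hex
      have hle : Nat.find hex ≤ N := Nat.find_min' hex ((hem1 j).trans hN)
      obtain ⟨k, hk⟩ : ∃ k, Nat.find hex = k + 1 := by
        apply Nat.exists_eq_succ_of_ne_zero
        intro hz
        rw [hz] at hs
        simp at hs
        exact hj hs
      have hmin := Nat.find_min hex (m := k) (by omega)
      rw [hk] at hs hle
      push Not at hmin hj
      have hm0 : 0 < empMean n x (f j) := hρ.trans hj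
      have h4 : (0:ℝ) < 4 ^ k := by positivity
      have hak : a j ≤ (1/4:ℝ) ^ k := by
        rw [one_div, inv_pow, ← one_div, le_div_iff₀ h4]
        have h5 := hem j
        have h6 : a j * (4 ^ k * ρ) ≤ ρ :=
          (mul_le_mul_of_nonneg_left hmin.le (ha j).1).trans h5
        have h7 : (a j * 4 ^ k) * ρ ≤ 1 * ρ := by linarith
        exact le_of_mul_le_mul_right h7 hρ
      have h1 := Finset.single_le_sum hterm (Finset.mem_range.2 hle)
      have h2 : a j * |radAvg n x σ (f j)| ≤ (1/4:ℝ) ^ k * Q (4 ^ (k+1) * ρ) σ :=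
        mul_le_mul hak (hQle _ σ j hs) (abs_nonneg _) (by positivity)
      have h3 := hQ0 ρ σ
      linarith
  have h2n : (0:ℝ) < 2 ^ n := by positivity
  have hW : Wav n (fun j s => a j * f j s) x ≤ n * (radSup n (range f) x ρ +
      ∑ k ∈ Finset.range N, (1/4:ℝ) ^ k * radSup n (range f) x (4 ^ (k+1) * ρ)) := by
    simp only [hrad, Wav]
    have : (n:ℝ) * ((∑ σ, Q ρ σ) / 2 ^ n +
      ∑ k ∈ Finset.range N, (1/4:ℝ) ^ k * ((∑ σ, Q (4 ^ (k+1) * ρ) σ) / 2 ^ n)) =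
      (∑ σ, (n * (Q ρ σ + ∑ k ∈ Finset.range N, (1/4:ℝ) ^ k * Q (4 ^ (k+1) * ρ) σ))) / 2 ^ n := by
      rw [← Finset.mul_sum, mul_div_assoc, Finset.sum_add_distrib, add_div, Finset.sum_comm,
        Finset.sum_div (Finset.range N)]
      congr 2
      apply Finset.sum_congr rfl
      intro k _
      rw [← Finset.mul_sum, mul_div_assoc]
    rw [this]
    exact div_le_div_of_nonneg_right (Finset.sum_le_sum fun σ _ => hpt σ) h2n.le
  refine hW.trans (mul_le_mul_of_nonneg_left ?_ hn'.le)
  have hk : ∀ k : ℕ, (1/4:ℝ) ^ k * radSup n (range f) x (4 ^ (k+1) * ρ) ≤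
      (2 * ψ (Real.sqrt ρ)) * (1/2:ℝ) ^ k := by
    intro k
    have e : Real.sqrt (4 ^ (k+1) * ρ) = 2 ^ (k+1) * Real.sqrt ρ := by
      rw [Real.sqrt_mul (by positivity)]
      congr 1
      rw [show (4:ℝ) = 2 ^ 2 by norm_num, ← pow_mul, mul_comm, pow_mul]
      exact Real.sqrt_sq (by positivity)
    have h1 := hψ (4 ^ (k+1) * ρ) (by positivity)
    rw [e] at h1
    have h2 := conc_scale hc h0 (2 ^ (k+1)) (Real.sqrt ρ) (one_le_pow₀ (by norm_num))
      (Real.sqrt_nonneg _)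
    calc (1/4:ℝ) ^ k * radSup n (range f) x (4 ^ (k+1) * ρ)
        ≤ (1/4:ℝ) ^ k * (2 ^ (k+1) * ψ (Real.sqrt ρ)) :=
          mul_le_mul_of_nonneg_left (h1.trans h2) (by positivity)
      _ = (2 * ψ (Real.sqrt ρ)) * ((1/4:ℝ) ^ k * 2 ^ k) := by ring
      _ = (2 * ψ (Real.sqrt ρ)) * (1/2:ℝ) ^ k := by rw [← mul_pow]; norm_num
  have hgeo : ∑ k ∈ Finset.range N, (1/2:ℝ) ^ k ≤ 2 := sum_geometric_two_le N
  have hsum : ∑ k ∈ Finset.range N, (1/4:ℝ) ^ k * radSup n (range f) x (4 ^ (k+1) * ρ) ≤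
      (2 * ψ (Real.sqrt ρ)) * 2 := by
    refine (Finset.sum_le_sum fun k _ => hk k).trans ?_
    rw [← Finset.mul_sum]
    exact mul_le_mul_of_nonneg_left hgeo (by linarith)
  have := hψ ρ hρ.le
  linarith



/-- scaling factor -/
def scl (p r : ℝ) : ℝ := if p ≤ r then 1 else r / p

theorem scl_mem (p r : ℝ) (hr : 0 < r) : scl p r ∈ Icc (0:ℝ) 1 := by
  unfold scl
  split_ifs with h
  · simp
  · push Not at h
    have hp : 0 < p := hr.trans h
    exact ⟨by positivity, (div_le_one hp).2 h.le⟩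

theorem scl_mul (p r : ℝ) (hr : 0 < r) : scl p r * p ≤ r := by
  unfold scl
  split_ifs with h
  · linarith
  · push Not at h
    rw [div_mul_cancel₀ _ (hr.trans h).ne']

theorem scl_mono (p r r' : ℝ) (hr : 0 < r) (h : r ≤ r') : scl p r ≤ scl p r' := by
  by_cases h' : p ≤ r'
  · have : scl p r' = 1 := by simp [scl, h']
    rw [this]; exact (scl_mem p r hr).2
  · have h1 : ¬ p ≤ r := fun h2 => h' (h2.trans h)
    push Not at h' h1
    simp only [scl, not_le.2 h', not_le.2 h1, if_false]
    exact div_le_div_of_nonneg_right h (hr.trans h1).le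

section fin
variable {S : Type*} [MeasurableSpace S] (P : Measure S) [IsProbabilityMeasure P]
  (n : ℕ) {ι : Type*} [Finite ι] [Nonempty ι] (f : ι → S → ℝ)

/-- scaled family -/
def hfam (r : ℝ) (j : ι) (s : S) : ℝ := scl (∫ s, f j s ∂P) r * f j s

theorem hfam_BM (hf : ∀ j, BM (f j)) (r : ℝ) (j : ι) : BM (hfam P f r j) :=
  (BM.const _).mul (hf j)

theorem hfam_01 (h01 : ∀ j s, f j s ∈ Icc (0:ℝ) 1) (r : ℝ) (hr : 0 < r) (j : ι) (s : S) :
    hfam P f r j s ∈ Icc (0:ℝ) 1 := by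
  have h1 := scl_mem (∫ s, f j s ∂P) r hr
  have h2 := h01 j s
  exact ⟨mul_nonneg h1.1 h2.1, mul_le_one₀ h1.2 h2.1 h2.2⟩

theorem hfam_int (r : ℝ) (hr : 0 < r) (j : ι) : ∫ s, hfam P f r j s ∂P ≤ r := by
  simp only [hfam]
  rw [integral_const_mul]
  exact scl_mul _ _ hr

theorem Wav_mono (r r' : ℝ) (hr : 0 < r) (h : r ≤ r') (x : Fin n → S) :
    Wav n (hfam P f r) x ≤ Wav n (hfam P f r') x := by
  unfold Wav
  apply div_le_div_of_nonneg_right _ (by positivity)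
  apply Finset.sum_le_sum
  intro σ _
  apply ciSup_le
  intro j
  refine le_trans ?_ (le_iS _ j)
  have e : ∀ r, ∑ k, radSign (σ k) * hfam P f r j (x k) =
      scl (∫ s, f j s ∂P) r * ∑ k, radSign (σ k) * f j (x k) := by
    intro r
    rw [Finset.mul_sum]
    apply Finset.sum_congr rfl
    intro k _
    simp only [hfam]; ring
  rw [e, e, abs_mul, abs_mul, abs_of_nonneg (scl_mem _ r hr).1,
    abs_of_nonneg (scl_mem _ r' (hr.trans_le h)).1]
  exact mul_le_mul_of_nonneg_right (scl_mono _ _ _ hr h) (abs_nonneg _)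

theorem Wav_le (h : ι → S → ℝ) (h01 : ∀ j s, h j s ∈ Icc (0:ℝ) 1) (x : Fin n → S) :
    Wav n h x ≤ n := by
  unfold Wav
  rw [div_le_iff₀ (by positivity)]
  have : ∀ σ : Fin n → Bool, Tsup n h σ x ≤ n := by
    intro σ
    apply ciSup_le
    intro j
    refine (Finset.abs_sum_le_sum_abs _ _).trans ?_
    calc ∑ k, |radSign (σ k) * h j (x k)| ≤ ∑ _k : Fin n, (1:ℝ) :=
          Finset.sum_le_sum fun k _ => abs_radSign_le _ _ (h01 j _)
      _ = n := by simp
  calc ∑ σ, Tsup n h σ x ≤ ∑ _σ : Fin n → Bool, (n:ℝ) := Finset.sum_le_sum fun σ _ => this σ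
    _ = n * 2 ^ n := by simp [mul_comm]

theorem EW_mono (hf : ∀ j, BM (f j)) (r r' : ℝ) (hr : 0 < r) (h : r ≤ r') :
    ∫ x, Wav n (hfam P f r) x ∂(Measure.pi fun _ : Fin n => P) ≤
      ∫ x, Wav n (hfam P f r') x ∂(Measure.pi fun _ : Fin n => P) :=
  integral_mono ((BM_W n _ (hfam_BM P f hf r)).integrable _)
    ((BM_W n _ (hfam_BM P f hf r')).integrable _) fun x => Wav_mono P n f r r' hr h x

theorem EW_le (hf : ∀ j, BM (f j)) (h01 : ∀ j s, f j s ∈ Icc (0:ℝ) 1) (r : ℝ) (hr : 0 < r) :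
    ∫ x, Wav n (hfam P f r) x ∂(Measure.pi fun _ : Fin n => P) ≤ n := by
  have := integral_mono ((BM_W n _ (hfam_BM P f hf r)).integrable
    (Measure.pi fun _ : Fin n => P)) (integrable_const (n:ℝ))
    fun x => Wav_le n _ (hfam_01 P f h01 r hr) x
  simpa using this

/-- lower deviation event: from a small complexity at level `R` -/
theorem ev_a (hf : ∀ j, BM (f j)) (h01 : ∀ j s, f j s ∈ Icc (0:ℝ) 1) (hn : 0 < n) (R : ℝ)
    (hR : 0 < R)
    (hU : ∫ x, Wav n (hfam P f R) x ∂(Measure.pi fun _ : Fin n => P) ≤ n * R / 16) :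
    ∃ A : Set (Fin n → S), MeasurableSet A ∧
      (Measure.pi fun _ : Fin n => P).real A ≤ exp (-(n * R / 64)) ∧
      ∀ x ∉ A, ∀ j, ∫ s, f j s ∂P ≤ 2 * empMean n x (f j) + R := by
  set h := hfam P f R with hh
  have bh := hfam_BM P f hf R
  have bY : BM (fun x : Fin n → S => ⨆ j, ∑ i, (∫ s, h j s ∂P - h j (x i))) :=
    BM.iSup fun j => BM.sum _ fun k => (BM.const _).sub (BM_eval n (bh j) k)
  have bYa : BM (fun x : Fin n → S => ⨆ j, |∑ i, (∫ s, h j s ∂P - h j (x i))|) :=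
    BM.iSup fun j => (BM.sum _ fun k => (BM.const _).sub (BM_eval n (bh j) k)).abs
  refine ⟨{x | n * R / 2 ≤ ⨆ j, ∑ i, (∫ s, h j s ∂P - h j (x i))},
    measurableSet_le measurable_const bY.1, ?_, ?_⟩
  · refine (lower_dev P n h bh (hfam_01 P f h01 R hR) R (hfam_int P f R hR) (n * R / 2) (1/16)
      (by norm_num) (by norm_num)).trans ?_
    apply exp_le_exp.2
    have h1 : ∫ x, ⨆ j, ∑ i, (∫ s, h j s ∂P - h j (x i)) ∂(Measure.pi fun _ : Fin n => P) ≤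
        ∫ x, ⨆ j, |∑ i, (∫ s, h j s ∂P - h j (x i))| ∂(Measure.pi fun _ : Fin n => P) := by
      apply integral_mono (bY.integrable _) (bYa.integrable _)
      intro x
      apply ciSup_le
      intro j
      exact (le_abs_self _).trans (le_iS (fun j => |∑ i, (∫ s, h j s ∂P - h j (x i))|) j)
    have h2 := symm_W P n h bh
    linarith
  · intro x hx j
    have hn' : (0:ℝ) < n := by exact_mod_cast hn
    have hx' : (⨆ j, ∑ i, (∫ s, h j s ∂P - h j (x i))) < n * R / 2 := not_le.1 hx
    have h1 := (le_iS (fun j => ∑ i, (∫ s, h j s ∂P - h j (x i))) j).trans_lt hx'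
    have e : ∑ i, f j (x i) = n * empMean n x (f j) := by
      rw [empMean]; field_simp
    have hem : 0 ≤ empMean n x (f j) := by
      rw [empMean]
      exact div_nonneg (Finset.sum_nonneg fun i _ => (h01 j _).1) hn'.le
    by_cases hp : ∫ s, f j s ∂P ≤ R
    · linarith
    · simp only [hh, hfam] at h1
      rw [integral_const_mul] at h1
      simp only [scl, hp, if_false] at h1
      push Not at hp
      set p := ∫ s, f j s ∂P with hpd
      have hp0 : 0 < p := hR.trans hp
      rw [div_mul_cancel₀ _ hp0.ne', Finset.sum_sub_distrib, ← Finset.mul_sum, e] at h1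
      simp only [Finset.sum_const, Finset.card_univ, Fintype.card_fin, nsmul_eq_mul] at h1
      have h2 : n * (R / 2) < n * (R / p * empMean n x (f j)) := by linarith
      have h3 := lt_of_mul_lt_mul_left h2 hn'.le
      rw [div_mul_eq_mul_div, lt_div_iff₀ hp0] at h3
      have h4 : R * (p / 2) < R * empMean n x (f j) := by linarith
      have h5 := lt_of_mul_lt_mul_left h4 hR.le
      linarith

theorem ev_bc (hf : ∀ j, BM (f j)) (h01 : ∀ j s, f j s ∈ Icc (0:ℝ) 1) (hn : 0 < n) (r : ℝ)
    (hr : 0 < r)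
    (hU : ∫ x, Wav n (hfam P f r) x ∂(Measure.pi fun _ : Fin n => P) ≤ n * r / 8)
    (hL : n * r / 16 ≤ ∫ x, Wav n (hfam P f r) x ∂(Measure.pi fun _ : Fin n => P)) :
    ∃ A : Set (Fin n → S), MeasurableSet A ∧
      (Measure.pi fun _ : Fin n => P).real A ≤ 2 * exp (-(n * r / 64)) ∧
      ∀ x ∉ A, ∀ (ψ : ℝ → ℝ) (rh : ℝ), MonotoneOn ψ (Ici 0) → ConcaveOn ℝ (Ici 0) ψ → ψ 0 = 0 →
        (∀ r : ℝ, 0 ≤ r → radSup n (range f) x r ≤ ψ (Real.sqrt r)) →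
        (∀ ρ : ℝ, ρ = ψ (Real.sqrt ρ) → ρ ≤ rh) → (1 / 2560) ^ 2 * (8 * r) ≤ rh := by
  have hn' : (0:ℝ) < n := by exact_mod_cast hn
  set μ := Measure.pi fun _ : Fin n => P with hμ
  set h := hfam P f r with hh
  have bh := hfam_BM P f hf r
  have b01 := hfam_01 P f h01 r hr
  have bZ : BM (fun x : Fin n → S => ⨆ j, ∑ i, h j (x i)) :=
    BM.iSup fun j => BM.sum _ fun k => BM_eval n (bh j) k
  have bYa : BM (fun x : Fin n → S => ⨆ j, |∑ i, (∫ s, h j s ∂P - h j (x i))|) :=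
    BM.iSup fun j => (BM.sum _ fun k => (BM.const _).sub (BM_eval n (bh j) k)).abs
  have bW := BM_W n h bh
  refine ⟨{x | n * (8 * r) ≤ ⨆ j, ∑ i, h j (x i)} ∪ {x | Wav n h x ≤ n * r / 64},
    (measurableSet_le measurable_const bZ.1).union (measurableSet_le bW.1 measurable_const), ?_, ?_⟩
  · refine (measureReal_union_le _ _).trans ?_
    have h1 := Z_upper P n h bh b01 (n * (8 * r))
    have h2 := W_lower P n h bh b01 (n * r / 64)
    have h3 : ∫ x, ⨆ j, ∑ i, h j (x i) ∂μ ≤ n * r +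
        ∫ x, ⨆ j, |∑ i, (∫ s, h j s ∂P - h j (x i))| ∂μ := by
      have := integral_mono (bZ.integrable μ) (((BM.const (n * r)).add bYa).integrable μ) (by
        intro x
        apply ciSup_le
        intro j
        have h4 := (neg_le_abs _).trans (le_iS (fun j => |∑ i, (∫ s, h j s ∂P - h j (x i))|) j)
        have h5 := mul_le_mul_of_nonneg_left (hfam_int P f r hr j) hn'.le
        simp only [Finset.sum_sub_distrib, Finset.sum_const, Finset.card_univ, Fintype.card_fin,
          nsmul_eq_mul] at h4 ⊢
        linarith)
      rw [integral_add (integrable_const _) (bYa.integrable _)] at this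
      simpa using this
    have h4 := symm_W P n h bh
    have hnr : 0 < n * r := by positivity
    have h5 := exp_le_exp.2 (show ∫ x, ⨆ j, ∑ k, h j (x k) ∂μ - n * (8 * r) / 2 ≤
      -(n * r / 64) by linarith)
    have h6 := exp_le_exp.2 (show n * r / 64 - (∫ x, Wav n h x ∂μ) / 2 ≤
      -(n * r / 64) by linarith)
    linarith
  · intro x hx ψ rh hm hc h0 hψ hmax
    rw [Set.mem_union, not_or] at hx
    have hx1 : (⨆ j, ∑ i, h j (x i)) < n * (8 * r) := not_le.1 hx.1
    have hx2 : n * r / 64 < Wav n h x := not_le.1 hx.2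
    by_contra! hcon
    have h1 := psi_le_c hc h0 hmax (1/2560) (8 * r) (by norm_num) (by norm_num) hcon
    have h2 := dyadic hn f h01 (fun j => scl (∫ s, f j s ∂P) r) (fun j => scl_mem _ r hr) x (8 * r)
      (by positivity) (by
        intro j
        have h3 := (le_iS (fun j => ∑ i, h j (x i)) j).trans hx1.le
        simp only [hh, hfam, ← Finset.mul_sum] at h3
        simp only [empMean]
        rw [mul_div_assoc', div_le_iff₀ hn']
        linarith) hm hc h0 hψ
    have h3 : Wav n h x ≤ n * (5 * ψ (Real.sqrt (8 * r))) := h2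
    have h4 : n * (5 * ψ (Real.sqrt (8 * r))) ≤ n * (5 * (1 / 2560 * (8 * r))) := by gcongr
    linarith

theorem fin_main (hf : ∀ j, BM (f j)) (h01 : ∀ j s, f j s ∈ Icc (0:ℝ) 1) (hn : 0 < n) (t : ℝ)
    (ht : 0 < t) (ht2 : exp (-t) ≤ 1 / 2) :
    ∃ A : Set (Fin n → S), MeasurableSet A ∧
      (Measure.pi fun _ : Fin n => P).real A ≤ 2 * exp (-t) ∧
      ∀ x ∉ A, ∀ (ψ : ℝ → ℝ) (rh : ℝ), MonotoneOn ψ (Ici 0) → ConcaveOn ℝ (Ici 0) ψ → ψ 0 = 0 →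
        (∀ r : ℝ, 0 ≤ r → radSup n (range f) x r ≤ ψ (Real.sqrt r)) →
        (∀ ρ : ℝ, ρ = ψ (Real.sqrt ρ) → ρ ≤ rh) →
        ∀ j, ∫ s, f j s ∂P ≤ 2000000 * (empMean n x (f j) + rh + t / n) := by
  classical
  have hn' : (0:ℝ) < n := by exact_mod_cast hn
  have htn : 0 < t / n := by positivity
  set μ := Measure.pi fun _ : Fin n => P with hμ
  set EW : ℝ → ℝ := fun r => ∫ x, Wav n (hfam P f r) x ∂μ with hEW
  set r1 : ℝ := 128 * (t / n) with hr1
  have hr1p : 0 < r1 := by positivity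
  have hnr1 : n * r1 = 128 * t := by rw [hr1]; field_simp
  have hem : ∀ (x : Fin n → S) j, 0 ≤ empMean n x (f j) := by
    intro x j
    rw [empMean]
    exact div_nonneg (Finset.sum_nonneg fun i _ => (h01 j _).1) hn'.le
  have hex : ∃ k : ℕ, EW (2 ^ k * r1) ≤ n * (2 ^ k * r1) / 16 := by
    obtain ⟨k, hk⟩ := pow_unbounded_of_one_lt (16 / r1) (by norm_num : (1:ℝ) < 2)
    refine ⟨k, (EW_le P n f hf h01 _ (by positivity)).trans ?_⟩
    rw [div_lt_iff₀ hr1p] at hk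
    nlinarith
  have hexp : 3 * exp (-(2 * t)) ≤ 2 * exp (-t) := by
    have : exp (-(2 * t)) = exp (-t) * exp (-t) := by rw [← exp_add]; congr 1; ring
    rw [this]
    nlinarith [exp_pos (-t)]
  have hs := Nat.find_spec hex
  rcases Nat.eq_zero_or_pos (Nat.find hex) with hk | hk
  · rw [hk] at hs
    simp only [pow_zero, one_mul] at hs
    obtain ⟨A, hA, hA1, hA2⟩ := ev_a P n f hf h01 hn r1 hr1p hs
    refine ⟨A, hA, hA1.trans ?_, ?_⟩
    · rw [hnr1, show 128 * t / 64 = 2 * t by ring]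
      linarith [exp_pos (-(2 * t))]
    · intro x hx ψ rh hm hc h0 hψ hmax j
      have hrh : 0 ≤ rh := hmax 0 (by simp [h0])
      have := hA2 x hx j
      have := hem x j
      linarith
  · obtain ⟨k, hk'⟩ := Nat.exists_eq_succ_of_ne_zero hk.ne'
    have hmin := Nat.find_min hex (m := k) (by omega)
    rw [hk'] at hs
    push Not at hmin
    set r : ℝ := 2 ^ k * r1 with hr
    have hrp : 0 < r := by positivity
    have hr1r : r1 ≤ r := by
      rw [hr]
      exact le_mul_of_one_le_left hr1p.le (one_le_pow₀ (by norm_num))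
    have e2 : (2:ℝ) ^ (k.succ) * r1 = 2 * r := by rw [hr, Nat.succ_eq_add_one, pow_succ]; ring
    rw [e2] at hs
    obtain ⟨A, hA, hA1, hA2⟩ := ev_a P n f hf h01 hn (2 * r) (by positivity) hs
    have hU : EW r ≤ n * r / 8 := by
      have := EW_mono P n f hf r (2 * r) hrp (by linarith)
      have h' : EW r ≤ EW (2 * r) := this
      linarith
    obtain ⟨B, hB, hB1, hB2⟩ := ev_bc P n f hf h01 hn r hrp hU hmin.le
    have hnr : 128 * t ≤ n * r := by rw [← hnr1]; exact mul_le_mul_of_nonneg_left hr1r hn'.le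
    refine ⟨A ∪ B, hA.union hB, (measureReal_union_le _ _).trans ?_, ?_⟩
    · have h1 := exp_le_exp.2 (show -(n * (2 * r) / 64) ≤ -(2 * t) by linarith)
      have h2 := exp_le_exp.2 (show -(n * r / 64) ≤ -(2 * t) by linarith)
      linarith
    · intro x hx ψ rh hm hc h0 hψ hmax j
      rw [Set.mem_union, not_or] at hx
      have hrh : 0 ≤ rh := hmax 0 (by simp [h0])
      have h1 := hA2 x hx.1 j
      have h2 := hB2 x hx.2 ψ rh hm hc h0 hψ hmax
      have h3 := hem x j
      norm_num at h2
      linarith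

end fin

theorem radSup_mono {S : Type*} {n : ℕ} (hn : 0 < n) (F G : Set (S → ℝ)) (hFG : F ⊆ G)
    (h01 : ∀ f ∈ G, ∀ s, f s ∈ Icc (0:ℝ) 1) (x : Fin n → S) (u : ℝ) :
    radSup n F x u ≤ radSup n G x u := by
  have hn' : (0:ℝ) < n := by exact_mod_cast hn
  unfold radSup
  rw [integral_rad, integral_rad]
  apply div_le_div_of_nonneg_right _ (by positivity)
  apply Finset.sum_le_sum
  intro σ _
  apply Real.sSup_le
  · rintro b ⟨f, hf, hu, rfl⟩
    apply le_csSup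
    · refine ⟨1, ?_⟩
      rintro b ⟨g, hg, _, rfl⟩
      rw [radAvg, abs_div, abs_of_pos hn', div_le_one hn']
      refine (Finset.abs_sum_le_sum_abs _ _).trans ?_
      calc ∑ k, |radSign (σ k) * g (x k)| ≤ ∑ _k : Fin n, (1:ℝ) :=
            Finset.sum_le_sum fun k _ => abs_radSign_le _ _ (h01 g hg _)
        _ = n := by simp
    · exact ⟨f, hFG hf, hu, rfl⟩
  · apply Real.sSup_nonneg
    rintro b ⟨g, _, _, rfl⟩
    exact abs_nonneg _

/-- There is a universal constant `K > 0` such that: for any countable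
class `𝓕` of measurable `[0,1]`-valued functions, i.i.d. sample of size `n ≥ 3` with law
`P`, any (data-dependent) nondecreasing concave `ψₙ` with `ψₙ(0) = 0` dominating the
localized Rademacher complexity, and `r̂ₙ` the largest solution of `r = ψₙ(√r)`, for every
`t > 0`, with probability at least `1 - 2e^{-t}`, simultaneously for all `f ∈ 𝓕`,
`P f ≤ K (Pₙ f + r̂ₙ + (t + log log n)/n)`. -/
theorem generalization_bound_localized_rademacher :
    ∃ K : ℝ, 0 < K ∧
      ∀ (S : Type) [MeasurableSpace S] (P : Measure S) [IsProbabilityMeasure P]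
        (n : ℕ), 3 ≤ n →
        ∀ 𝓕 : Set (S → ℝ), 𝓕.Countable → (∀ f ∈ 𝓕, Measurable f) →
          (∀ f ∈ 𝓕, ∀ s, f s ∈ Icc (0 : ℝ) 1) →
          ∀ ψ : (Fin n → S) → ℝ → ℝ,
            (∀ x, MonotoneOn (ψ x) (Ici 0)) →
            (∀ x, ConcaveOn ℝ (Ici 0) (ψ x)) →
            (∀ x, ψ x 0 = 0) →
            (∀ x, ∀ r : ℝ, 0 ≤ r → radSup n 𝓕 x r ≤ ψ x (Real.sqrt r)) →
            ∀ rhat : (Fin n → S) → ℝ,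
              (∀ x, rhat x = ψ x (Real.sqrt (rhat x)) ∧
                ∀ ρ : ℝ, ρ = ψ x (Real.sqrt ρ) → ρ ≤ rhat x) →
              ∀ t : ℝ, 0 < t →
                ENNReal.ofReal (1 - 2 * Real.exp (-t)) ≤
                  (Measure.pi fun _ : Fin n => P) {x | ∀ f ∈ 𝓕,
                    ∫ s, f s ∂P ≤
                      K * (empMean n x f + rhat x + (t + Real.log (Real.log n)) / n)} := by
  refine ⟨2000000, by norm_num, ?_⟩
  intro S _ P _ n hn3 F hFc hFm hF01 ψ hm hc h0 hψ rhat hrh t ht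
  have hn : 0 < n := by omega
  have hn' : (0:ℝ) < n := by exact_mod_cast hn
  by_cases ht2 : 1 / 2 < exp (-t)
  · rw [ENNReal.ofReal_of_nonpos (by linarith)]
    exact zero_le
  push Not at ht2
  set μ := Measure.pi fun _ : Fin n => P with hμ
  have hll : 0 ≤ Real.log (Real.log n) := by
    apply Real.log_nonneg
    rw [Real.le_log_iff_exp_le hn']
    have h1 := Real.exp_one_lt_d9
    have h2 : (3:ℝ) ≤ n := by exact_mod_cast hn3
    linarith
  have htn : t / n ≤ (t + Real.log (Real.log n)) / n :=
    div_le_div_of_nonneg_right (by linarith) hn'.le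
  rcases F.eq_empty_or_nonempty with rfl | hne
  · simp only [mem_empty_iff_false, false_implies, implies_true, setOf_true, measure_univ]
    rw [ENNReal.ofReal_le_one]
    linarith [exp_pos (-t)]
  obtain ⟨g, rfl⟩ := hFc.exists_eq_range hne
  have key : ∀ m : ℕ, ∃ A : Set (Fin n → S), MeasurableSet A ∧ μ.real A ≤ 2 * exp (-t) ∧
      ∀ x ∉ A, ∀ j ≤ m, ∫ s, g j s ∂P ≤ 2000000 * (empMean n x (g j) + rhat x + t / n) := by
    intro m
    obtain ⟨A, hA, hA1, hA2⟩ := fin_main P n (fun j : Fin (m+1) => g j)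
      (fun j => ⟨hFm _ ⟨_, rfl⟩, 1, fun s => by
        have := hF01 (g j) ⟨_, rfl⟩ s
        rw [abs_of_nonneg this.1]; exact this.2⟩)
      (fun j s => hF01 (g j) ⟨_, rfl⟩ s) hn t ht ht2
    refine ⟨A, hA, hA1, fun x hx j hj => ?_⟩
    refine hA2 x hx (ψ x) (rhat x) (hm x) (hc x) (h0 x) (fun r hr => ?_) (hrh x).2
      ⟨j, by omega⟩
    refine (radSup_mono hn _ _ ?_ hF01 x r).trans (hψ x r hr)
    rintro _ ⟨i, rfl⟩
    exact ⟨i, rfl⟩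
  choose A hA hA1 hA2 using key
  set D : ℕ → Set (Fin n → S) := fun N => ⋂ m ≥ N, A m with hD
  have hDmono : Monotone D := by
    intro N M h x hx
    simp only [hD, mem_iInter] at hx ⊢
    exact fun m hmm => hx m (h.trans hmm)
  have hDm : ∀ N, MeasurableSet (D N) := fun N =>
    MeasurableSet.iInter fun m => MeasurableSet.iInter fun _ => hA m
  have hDle : μ (⋃ N, D N) ≤ ENNReal.ofReal (2 * exp (-t)) := by
    rw [hDmono.measure_iUnion]
    apply iSup_le
    intro N
    refine (measure_mono (show D N ⊆ A N from fun x hx => ?_)).trans ?_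
    · simp only [hD, mem_iInter] at hx
      exact hx N le_rfl
    · rw [← ofReal_measureReal]
      exact ENNReal.ofReal_le_ofReal (hA1 N)
  have hcompl := prob_compl_eq_one_sub (μ := μ) (MeasurableSet.iUnion hDm)
  calc ENNReal.ofReal (1 - 2 * exp (-t)) = 1 - ENNReal.ofReal (2 * exp (-t)) := by
        rw [ENNReal.ofReal_sub _ (by positivity), ENNReal.ofReal_one]
    _ ≤ μ (⋃ N, D N)ᶜ := by rw [hcompl]; exact tsub_le_tsub_left hDle 1
    _ ≤ _ := measure_mono ?_
  intro x hx
  rintro _ ⟨j, rfl⟩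
  simp only [mem_compl_iff, mem_iUnion, hD, mem_iInter, not_exists, not_forall] at hx
  obtain ⟨m, hmj, hxm⟩ := hx j
  have := hA2 m x hxm j hmj
  linarith
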